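/- arXiv:2601.07097 — 4 statements merged into one kernel-verified Lean document; each statement's English description precedes it below -/
import Mathlib

section
/- For all b ≥ 2 and ε > 0 there exist δ > 0 and a constant C = C(b,ε) such that for all x and all D ≥ x^{3/13+ε} one has S_b(x,D) ≤ C x^{1/2−δ}. -/
/-- A positive integer `n` is a base-`b` palindrome if `b ∤ n` and its base-`b`
digit string reads the same forwards and backwards. -/
def IsBPalindrome (b n : ℕ) : Prop := ¬ b ∣ n ∧ (Nat.digits b n).Palindrome

/-- `𝒫*_b(x)`: base-`b` palindromes `n ≤ x` with `gcd(n, b³ - b) = 1`. -/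
def PstarSet (b : ℕ) (x : ℝ) : Set ℕ :=
  {n : ℕ | 0 < n ∧ (n : ℝ) ≤ x ∧ IsBPalindrome b n ∧ Nat.gcd n (b ^ 3 - b) = 1}

/-- `S_b(x, D)`: the number of `n ∈ 𝒫*_b(x)` divisible by `d²` for some
integer `d` with `D ≤ d ≤ 2D`. -/
noncomputable def Scount (b : ℕ) (x D : ℝ) : ℕ :=
  {n : ℕ | n ∈ PstarSet b x ∧ ∃ d : ℕ, D ≤ (d : ℝ) ∧ (d : ℝ) ≤ 2 * D ∧ d ^ 2 ∣ n}.ncard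

theorem dvd_four_mul_sub_of_dvd_pow_four_sub {b z z' q : ℤ} {l : ℕ} (hq : q ∣ b ^ l)
    (hz : IsCoprime z b) (h8 : 8 * b ∣ z' - z) (h : q ∣ z' ^ 4 - z ^ 4) :
    q ∣ 4 * (z' - z) := by
  obtain ⟨y, hy⟩ := h8
  obtain rfl : z' = z + 8 * b * y := by linarith
  have hS : IsCoprime (z ^ 3 + b * (12 * z ^ 2 * y + 64 * b * y ^ 2 * z + 128 * b ^ 2 * y ^ 3)) b :=
    (hz.pow_left (m := 3)).add_mul_left_left _
  have hqS := (hS.pow_right (n := l)).of_isCoprime_of_dvd_right hq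
  have e : (z + 8 * b * y) ^ 4 - z ^ 4 = 4 * (z + 8 * b * y - z) *
      (z ^ 3 + b * (12 * z ^ 2 * y + 64 * b * y ^ 2 * z + 128 * b ^ 2 * y ^ 3)) := by ring
  exact hqS.symm.dvd_of_dvd_mul_right (e ▸ h)

theorem card_le_of_pow_four_congr {b q g l y : ℕ} (hb : 0 < b) (hq : q ∣ b ^ l) (hq0 : 0 < q)
    (Z : Finset ℕ) (hZ : ∀ z ∈ Z, y ≤ z ∧ z < y + g * q ∧ Nat.Coprime z b)
    (h : ∀ z ∈ Z, ∀ z' ∈ Z, (q : ℤ) ∣ (z' : ℤ) ^ 4 - (z : ℤ) ^ 4) :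
    Z.card ≤ 32 * b * g := by
  have key : Z.card ≤ (Finset.range (8 * b) ×ˢ Finset.range (4 * g)).card := by
    refine Finset.card_le_card_of_injOn (fun z => (z % (8 * b), 4 * (z - y) / q)) ?_ ?_
    · intro z hz
      obtain ⟨h1, h2, -⟩ := hZ z hz
      simp only [Finset.coe_product, Finset.coe_range, Set.mem_prod, Set.mem_Iio]
      refine ⟨Nat.mod_lt _ (by omega), ?_⟩
      rw [Nat.div_lt_iff_lt_mul hq0]
      have : z - y < g * q := by omega
      nlinarith
    · intro z hz z' hz' heq
      simp only [Prod.mk.injEq] at heq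
      obtain ⟨e1, e2⟩ := heq
      obtain ⟨h1, -, h3⟩ := hZ z hz
      obtain ⟨h1', -, -⟩ := hZ z' hz'
      have hd := dvd_four_mul_sub_of_dvd_pow_four_sub (b := b) (l := l) (by exact_mod_cast hq)
        (Nat.isCoprime_iff_coprime.mpr h3) (by exact_mod_cast (Nat.modEq_iff_dvd.mp e1))
        (h z hz z' hz')
      have hlt : |4 * ((z' : ℤ) - z)| < q := by
        have a1 := Nat.div_add_mod (4 * (z - y)) q
        have a2 := Nat.div_add_mod (4 * (z' - y)) q
        rw [← e2] at a2
        have a3 := Nat.mod_lt (4 * (z - y)) hq0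
        have a4 := Nat.mod_lt (4 * (z' - y)) hq0
        rw [abs_lt]
        generalize q * (4 * (z - y) / q) = w at a1 a2
        generalize 4 * (z - y) % q = w1 at a1 a3
        generalize 4 * (z' - y) % q = w2 at a2 a4
        omega
      have := Int.eq_zero_of_abs_lt_dvd hd hlt
      omega
  rw [Finset.card_product, Finset.card_range, Finset.card_range] at key
  linarith

/-- The additive character `θ ↦ exp(2πiθ)` of the real line. -/
noncomputable def unitExp (θ : ℝ) : ℂ := Complex.exp ((2 * Real.pi * θ : ℝ) * Complex.I)

theorem unitExp_add (s t : ℝ) : unitExp (s + t) = unitExp s * unitExp t := by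
  simp only [unitExp, ← Complex.exp_add]
  congr 1
  push_cast
  ring

theorem norm_unitExp (t : ℝ) : ‖unitExp t‖ = 1 := Complex.norm_exp_ofReal_mul_I _

theorem conj_unitExp (t : ℝ) : (starRingEnd ℂ) (unitExp t) = unitExp (-t) := by
  simp only [unitExp, ← Complex.exp_conj]
  congr 1
  rw [map_mul, Complex.conj_ofReal, Complex.conj_I]
  push_cast
  ring

theorem unitExp_nat_mul (n : ℕ) (t : ℝ) : unitExp (n * t) = unitExp t ^ n := by
  simp only [unitExp, ← Complex.exp_nat_mul]
  congr 1
  push_cast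
  ring

theorem unitExp_sub_int (t : ℝ) (k : ℤ) : unitExp (t - k) = unitExp t := by
  simp only [unitExp]
  rw [← Complex.exp_periodic.sub_int_mul_eq (x := ((2 * Real.pi * t : ℝ) : ℂ) * Complex.I) k]
  congr 1
  push_cast
  ring

theorem unitExp_re (t : ℝ) : (unitExp t).re = Real.cos (2 * Real.pi * t) := by
  simp only [unitExp, Complex.exp_ofReal_mul_I_re]

theorem norm_unitExp_sub_one_ge {θ ξ : ℝ} (h : ∀ k : ℤ, ξ ≤ |θ - k|) :
    4 * ξ ≤ ‖unitExp θ - 1‖ := by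
  rw [← unitExp_sub_int θ (round θ)]
  have h1 := h (round θ)
  have h2 := abs_sub_round θ
  set s := θ - round θ
  have e1 : unitExp s - 1 = Complex.exp (Complex.I * ((2 * Real.pi * s : ℝ) : ℂ)) - 1 := by
    rw [unitExp, mul_comm]
  rw [e1, Complex.norm_exp_I_mul_ofReal_sub_one, Real.norm_eq_abs, abs_mul, abs_two]
  have e2 : 2 * Real.pi * s / 2 = Real.pi * s := by ring
  rw [e2]
  have h3 : 2 * |s| ≤ |Real.sin (Real.pi * s)| := by
    have := Real.mul_abs_le_abs_sin (x := Real.pi * s) (by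
      rw [abs_mul, abs_of_pos Real.pi_pos]
      nlinarith [Real.pi_pos])
    rw [abs_mul, abs_of_pos Real.pi_pos] at this
    convert this using 1
    field_simp
  linarith

theorem norm_sum_unitExp_le {θ ξ : ℝ} (hξ : 0 < ξ) (h : ∀ k : ℤ, ξ ≤ |θ - k|) (n : ℕ) :
    ‖∑ t ∈ Finset.range n, unitExp (θ * t)‖ ≤ 1 / (2 * ξ) := by
  have h1 := norm_unitExp_sub_one_ge h
  have h2 : unitExp θ ≠ 1 := by
    intro h3
    rw [h3, sub_self, norm_zero] at h1
    linarith
  have h4 : ∑ t ∈ Finset.range n, unitExp (θ * t) = ∑ t ∈ Finset.range n, unitExp θ ^ t := by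
    refine Finset.sum_congr rfl fun t _ => ?_
    rw [mul_comm, unitExp_nat_mul]
  rw [h4, geom_sum_eq h2, norm_div, div_le_div_iff₀ (by linarith) (by positivity), one_mul]
  have h5 : ‖unitExp θ ^ n - 1‖ ≤ 2 := by
    refine (norm_sub_le _ _).trans ?_
    rw [norm_pow, norm_unitExp]
    norm_num
  nlinarith

theorem norm_sum_unitExp_le_card (f : ℕ → ℝ) (n : ℕ) :
    ‖∑ t ∈ Finset.range n, unitExp (f t)‖ ≤ n := by
  refine (norm_sum_le _ _).trans ?_
  simp [norm_unitExp]

theorem normSq_sum_range_le (z : ℕ → ℂ) (n : ℕ) :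
    ‖∑ t ∈ Finset.range n, z t‖ ^ 2 ≤
      2 * (∑ t' ∈ Finset.range n, z t' *
        (starRingEnd ℂ) (∑ t ∈ Finset.range (t' + 1), z t)).re := by
  induction n with
  | zero => simp
  | succ n ih =>
    rw [Finset.sum_range_succ (fun t' => z t' * (starRingEnd ℂ) _) n, Complex.add_re]
    rw [Finset.sum_range_succ z n]
    set s := ∑ t ∈ Finset.range n, z t
    rw [← Complex.normSq_eq_norm_sq] at ih ⊢
    have : Complex.normSq (s + z n) + Complex.normSq (z n) =
        Complex.normSq s + 2 * (z n * (starRingEnd ℂ) (s + z n)).re := by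
      simp only [Complex.normSq_apply, Complex.mul_re, Complex.conj_re, Complex.conj_im,
        Complex.add_re, Complex.add_im]
      ring
    have h2 := Complex.normSq_nonneg (z n)
    linarith

/-- Weyl differencing for a quadratic exponential sum. -/
theorem norm_sq_sum_unitExp_quadratic_le (α β γ : ℝ) (T : ℕ) :
    ‖∑ t ∈ Finset.range T, unitExp (γ + β * t + α * (t : ℝ) ^ 2)‖ ^ 2 ≤
      2 * ∑ h ∈ Finset.range T, ‖∑ t ∈ Finset.range (T - h), unitExp (2 * α * h * t)‖ := by
  refine (normSq_sum_range_le _ T).trans ?_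
  refine mul_le_mul_of_nonneg_left ?_ zero_le_two
  refine (Complex.re_le_norm _).trans ?_
  set P : ℕ → ℝ := fun t => γ + β * t + α * (t : ℝ) ^ 2
  have e1 : ∑ t' ∈ Finset.range T, unitExp (P t') *
        (starRingEnd ℂ) (∑ t ∈ Finset.range (t' + 1), unitExp (P t)) =
      ∑ h ∈ Finset.range T, ∑ t ∈ Finset.range (T - h), unitExp (P (t + h) - P t) := by
    rw [← Finset.sum_range_diag_flip T (fun h t => unitExp (P (t + h) - P t))]
    refine Finset.sum_congr rfl fun t' _ => ?_
    rw [← Finset.sum_range_reflect, map_sum, Finset.mul_sum]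
    refine Finset.sum_congr rfl fun h hh => ?_
    have hle : h ≤ t' := Nat.lt_succ_iff.mp (Finset.mem_range.mp hh)
    rw [conj_unitExp, ← unitExp_add, Nat.sub_add_cancel hle, ← sub_eq_add_neg]
    congr 4
  rw [e1]
  refine (norm_sum_le _ _).trans (Finset.sum_le_sum fun h _ => ?_)
  have e2 : ∀ t : ℕ, unitExp (P (t + h) - P t) =
      unitExp (β * h + α * (h : ℝ) ^ 2) * unitExp (2 * α * h * t) := by
    intro t
    rw [← unitExp_add]
    congr 1
    simp only [P]
    push_cast
    ring
  simp only [e2]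
  rw [← Finset.mul_sum, norm_mul, norm_unitExp, one_mul]

/-- Fejér-kernel bound for the number of terms close to an integer. -/
theorem card_near_int_mul_sq_le (f : ℕ → ℝ) (T R : ℕ) (hR : 0 < R) (G : Finset ℕ)
    (hG : ∀ t ∈ G, t < T ∧ ∃ k : ℤ, |f t - k| ≤ 1 / (6 * R)) :
    (G.card : ℝ) * R ^ 2 ≤ 4 * ∑ r ∈ Finset.range R, ∑ s ∈ Finset.range R,
      ‖∑ t ∈ Finset.range T, unitExp (((r : ℤ) - (s : ℤ) : ℤ) * f t)‖ := by
  have hR' : (0 : ℝ) < R := by exact_mod_cast hR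
  have h1 : ∀ t ∈ G, ((R : ℝ) / 2) ^ 2 ≤ ‖∑ r ∈ Finset.range R, unitExp (r * f t)‖ ^ 2 := by
    intro t ht
    obtain ⟨-, k, hk⟩ := hG t ht
    refine pow_le_pow_left₀ (by positivity) ?_ 2
    refine le_trans ?_ (Complex.re_le_norm _)
    rw [Complex.re_sum]
    have : ∀ r ∈ Finset.range R, (1 : ℝ) / 2 ≤ (unitExp (r * f t)).re := by
      intro r hr
      have hr' : (r : ℝ) ≤ R := by exact_mod_cast (Finset.mem_range.mp hr).le
      have e1 : unitExp (r * f t) = unitExp (r * (f t - k)) := by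
        rw [← unitExp_sub_int (r * f t) (r * k)]
        congr 1
        push_cast
        ring
      rw [e1, unitExp_re, ← Real.cos_abs, ← Real.cos_pi_div_three]
      have h3 : |(r : ℝ) * (f t - k)| ≤ 1 / 6 := by
        rw [abs_mul, abs_of_nonneg (Nat.cast_nonneg r)]
        calc (r : ℝ) * |f t - k| ≤ R * (1 / (6 * R)) := by gcongr
          _ = 1 / 6 := by field_simp
      have h4 : |2 * Real.pi * (r * (f t - k))| ≤ Real.pi / 3 := by
        rw [abs_mul, abs_of_pos (by positivity)]
        nlinarith [Real.pi_pos]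
      exact Real.cos_le_cos_of_nonneg_of_le_pi (abs_nonneg _) (by linarith [Real.pi_pos]) h4
    calc (R : ℝ) / 2 = ∑ r ∈ Finset.range R, (1 : ℝ) / 2 := by simp; ring
      _ ≤ _ := Finset.sum_le_sum this
  have h2 : (G.card : ℝ) * ((R : ℝ) / 2) ^ 2 ≤
      ∑ t ∈ Finset.range T, ‖∑ r ∈ Finset.range R, unitExp (r * f t)‖ ^ 2 := by
    rw [← nsmul_eq_mul, ← Finset.sum_const]
    refine (Finset.sum_le_sum h1).trans ?_
    refine Finset.sum_le_sum_of_subset_of_nonneg ?_ fun _ _ _ => by positivity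
    intro t ht
    exact Finset.mem_range.mpr (hG t ht).1
  have h3 : ∑ t ∈ Finset.range T, ‖∑ r ∈ Finset.range R, unitExp (r * f t)‖ ^ 2 =
      (∑ r ∈ Finset.range R, ∑ s ∈ Finset.range R,
      ∑ t ∈ Finset.range T, unitExp (((r : ℤ) - (s : ℤ) : ℤ) * f t)).re := by
    have e1 : ∀ t, ((‖∑ r ∈ Finset.range R, unitExp (r * f t)‖ ^ 2 : ℝ) : ℂ) =
        ∑ r ∈ Finset.range R, ∑ s ∈ Finset.range R,
          unitExp (((r : ℤ) - (s : ℤ) : ℤ) * f t) := by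
      intro t
      rw [← Complex.normSq_eq_norm_sq, ← Complex.mul_conj, map_sum, Finset.sum_mul_sum]
      refine Finset.sum_congr rfl fun r _ => Finset.sum_congr rfl fun s _ => ?_
      rw [conj_unitExp, ← unitExp_add]
      congr 1
      push_cast
      ring
    rw [← Complex.ofReal_re (∑ t ∈ Finset.range T, _), Complex.ofReal_sum]
    simp only [e1]
    rw [Finset.sum_comm]
    congr 1
    exact Finset.sum_congr rfl fun r _ => Finset.sum_comm
  rw [h3] at h2
  have h4 := h2.trans ((Complex.re_le_norm _).trans ((norm_sum_le _ _).trans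
    (Finset.sum_le_sum fun r _ => norm_sum_le _ _)))
  linarith

theorem one_div_pow_four_sub_le {y d L D : ℝ} (hD : 0 < D) (hy : D ≤ y) (h1 : y ≤ d)
    (h2 : d ≤ y + L) : |1 / d ^ 4 - 1 / y ^ 4| ≤ 4 * L / D ^ 5 := by
  have hy0 : 0 < y := hD.trans_le hy
  have hd0 : 0 < d := hy0.trans_le h1
  have hL : 0 ≤ L := by linarith
  have e : 1 / d ^ 4 - 1 / y ^ 4 =
      -((d - y) * (d ^ 3 + d ^ 2 * y + d * y ^ 2 + y ^ 3) / (d ^ 4 * y ^ 4)) := by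
    field_simp
    ring
  have hdy : 0 ≤ d - y := by linarith
  rw [e, abs_neg, abs_of_nonneg (by positivity)]
  have h3 : (d - y) * (d ^ 3 + d ^ 2 * y + d * y ^ 2 + y ^ 3) ≤ L * (4 * d ^ 3) := by
    refine mul_le_mul (by linarith) ?_ (by positivity) hL
    have a1 : d ^ 2 * y ≤ d ^ 2 * d := by gcongr
    have a2 : d * y ^ 2 ≤ d * d ^ 2 := by gcongr
    have a3 : y ^ 3 ≤ d ^ 3 := by gcongr
    nlinarith
  calc _ ≤ L * (4 * d ^ 3) / (d ^ 4 * y ^ 4) := by gcongr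
    _ = 4 * L / (d * y ^ 4) := by field_simp
    _ ≤ 4 * L / (D * D ^ 4) := by
      have : D ≤ d := hy.trans h1
      gcongr
    _ = 4 * L / D ^ 5 := by ring

theorem abs_inv_sq_sub_taylor_le {d s D : ℝ} (hD : 0 < D) (hd : D ≤ d) (hs : 0 ≤ s) (hsD : s ≤ D) :
    |1 / (d + s) ^ 2 - (d ^ 2 - 2 * d * s + 3 * s ^ 2) / d ^ 4| ≤ 7 * s ^ 3 / D ^ 5 := by
  have hd0 : 0 < d := hD.trans_le hd
  have e : 1 / (d + s) ^ 2 - (d ^ 2 - 2 * d * s + 3 * s ^ 2) / d ^ 4 =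
      -(s ^ 3 * (4 * d + 3 * s) / (d ^ 4 * (d + s) ^ 2)) := by
    field_simp
    ring
  rw [e, abs_neg, abs_of_nonneg (by positivity)]
  calc s ^ 3 * (4 * d + 3 * s) / (d ^ 4 * (d + s) ^ 2)
      ≤ s ^ 3 * (4 * d + 3 * d) / (d ^ 4 * (d + 0) ^ 2) := by
        gcongr
        linarith
    _ = 7 * s ^ 3 / d ^ 5 := by field_simp; ring
    _ ≤ 7 * s ^ 3 / D ^ 5 := by gcongr

theorem dvd_sub_inverse_sq_taylor {d s m n₀ u K : ℤ} (hs : K ∣ s ^ 3) (hu : K ∣ u * d - 1)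
    (hm : K ∣ (d + s) ^ 2 * m - n₀) :
    K ∣ m - n₀ * u ^ 4 * (d ^ 2 - 2 * d * s + 3 * s ^ 2) := by
  have e : m - n₀ * u ^ 4 * (d ^ 2 - 2 * d * s + 3 * s ^ 2) =
      ((d + s) ^ 2 * m - n₀) * (u ^ 4 * (d ^ 2 - 2 * d * s + 3 * s ^ 2)) -
      s ^ 3 * (m * u ^ 4 * (4 * d + 3 * s)) -
      (u * d - 1) * (m * (1 + u * d + (u * d) ^ 2 + (u * d) ^ 3)) := by ring
  rw [e]
  exact dvd_sub (dvd_sub (hm.mul_right _) (hs.mul_right _)) (hu.mul_right _)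

/-- If `d = d₀ + L t` has square dividing an integer near `n₀` and congruent to `n₀`,
then a certain quadratic polynomial in `t` is close to an integer. -/
theorem exists_int_near_quadratic {b L R d₀ t : ℕ} {m n₀ u : ℤ} {x D : ℝ}
    (hL : 0 < L) (hR : 0 < R) (hD : 0 < D) (hd₀ : D ≤ d₀) (ht : t < R ^ 4)
    (hTL : (R : ℝ) ^ 4 * L ≤ D) (hn₀ : 0 ≤ n₀) (hn₀x : (n₀ : ℝ) ≤ x)
    (h1 : 12 * b * x * R ≤ (L : ℝ) ^ 6 * D ^ 2) (h2 : 84 * x * (R : ℝ) ^ 13 ≤ D ^ 5)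
    (hu : (L : ℤ) ^ 3 ∣ u * d₀ - 1)
    (hm : (L : ℤ) ^ 3 ∣ ((d₀ + L * t : ℕ) : ℤ) ^ 2 * m - n₀)
    (hclose : |((d₀ + L * t : ℕ) : ℝ) ^ 2 * m - n₀| * L ^ 3 ≤ b * x) :
    ∃ k : ℤ, |(n₀ * (1 / (d₀ : ℝ) ^ 4 - u ^ 4) / L ^ 3 * d₀ ^ 2 +
      (-(2 * d₀ * (n₀ * (1 / (d₀ : ℝ) ^ 4 - u ^ 4) / L ^ 2))) * t +
      3 * n₀ * (1 / (d₀ : ℝ) ^ 4 - u ^ 4) / L * (t : ℝ) ^ 2) - k| ≤ 1 / (6 * (R : ℝ)) := by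
  push_cast at hm hclose
  obtain ⟨k, hk⟩ := dvd_sub_inverse_sq_taylor (s := L * t) ⟨t ^ 3, by ring⟩ hu hm
  refine ⟨k, ?_⟩
  have hL' : (0 : ℝ) < L := by exact_mod_cast hL
  have hR' : (0 : ℝ) < R := by exact_mod_cast hR
  have hd' : (0 : ℝ) < d₀ := hD.trans_le hd₀
  have hn' : (0 : ℝ) ≤ n₀ := by exact_mod_cast hn₀
  have hx : 0 ≤ x := hn'.trans hn₀x
  set s : ℝ := L * t with hs
  have hs0 : 0 ≤ s := by positivity
  have htR : (t : ℝ) ≤ (R : ℝ) ^ 4 := by exact_mod_cast ht.le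
  have hsT : s ≤ R ^ 4 * L := by rw [hs, mul_comm]; gcongr
  have hk' : (m : ℝ) - n₀ * u ^ 4 * (d₀ ^ 2 - 2 * d₀ * s + 3 * s ^ 2) = L ^ 3 * k := by
    rw [hs]
    exact_mod_cast hk
  have e1 : (n₀ * (1 / (d₀ : ℝ) ^ 4 - u ^ 4) / L ^ 3 * d₀ ^ 2 +
      (-(2 * d₀ * (n₀ * (1 / (d₀ : ℝ) ^ 4 - u ^ 4) / L ^ 2))) * t +
      3 * n₀ * (1 / (d₀ : ℝ) ^ 4 - u ^ 4) / L * (t : ℝ) ^ 2) - k =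
      -((((d₀ + s) ^ 2 * m - n₀) / (d₀ + s) ^ 2 + n₀ * (1 / (d₀ + s) ^ 2 -
        (d₀ ^ 2 - 2 * d₀ * s + 3 * s ^ 2) / d₀ ^ 4)) / L ^ 3) := by
    have hk2 : (k : ℝ) = (m - n₀ * u ^ 4 * (d₀ ^ 2 - 2 * d₀ * s + 3 * s ^ 2)) / L ^ 3 := by
      rw [hk']
      field_simp
    have hds : (d₀ : ℝ) + s ≠ 0 := by positivity
    have e2 : (((d₀ : ℝ) + s) ^ 2 * m - n₀) / (d₀ + s) ^ 2 = m - n₀ * (1 / (d₀ + s) ^ 2) := by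
      field_simp
    rw [hk2, e2, hs]
    field_simp
    ring
  rw [e1, abs_neg, abs_div, abs_of_pos (show (0 : ℝ) < L ^ 3 by positivity)]
  have b1 : |(((d₀ : ℝ) + s) ^ 2 * m - n₀) / (d₀ + s) ^ 2| ≤ b * x / (L ^ 3 * D ^ 2) := by
    rw [abs_div, abs_of_pos (show (0 : ℝ) < (d₀ + s) ^ 2 by positivity)]
    rw [div_le_div_iff₀ (by positivity) (by positivity)]
    have : D ^ 2 ≤ (d₀ + s) ^ 2 := by gcongr; linarith
    calc _ = |((d₀ : ℝ) + s) ^ 2 * m - n₀| * L ^ 3 * D ^ 2 := by ring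
      _ ≤ b * x * (d₀ + s) ^ 2 := by gcongr
  have b2 : |(n₀ : ℝ) * (1 / (d₀ + s) ^ 2 - (d₀ ^ 2 - 2 * d₀ * s + 3 * s ^ 2) / d₀ ^ 4)| ≤
      x * (7 * (R ^ 4 * L) ^ 3 / D ^ 5) := by
    rw [abs_mul, abs_of_nonneg hn']
    refine mul_le_mul hn₀x ?_ (abs_nonneg _) hx
    refine (abs_inv_sq_sub_taylor_le hD hd₀ hs0 (hsT.trans hTL)).trans ?_
    gcongr
  rw [div_le_iff₀ (by positivity)]
  refine (abs_add_le _ _).trans ((add_le_add b1 b2).trans ?_)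
  have c1 : b * x / (L ^ 3 * D ^ 2) ≤ L ^ 3 / (12 * R) := by
    rw [div_le_div_iff₀ (by positivity) (by positivity)]
    linarith
  have c2 : x * (7 * (R ^ 4 * L) ^ 3 / D ^ 5) ≤ L ^ 3 / (12 * R) := by
    rw [← mul_div_assoc, div_le_div_iff₀ (by positivity) (by positivity)]
    calc _ = L ^ 3 * (84 * x * (R : ℝ) ^ 13) := by ring
      _ ≤ L ^ 3 * D ^ 5 := by gcongr
  calc _ ≤ (L : ℝ) ^ 3 / (12 * R) + L ^ 3 / (12 * R) := add_le_add c1 c2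
    _ = _ := by field_simp; norm_num

/-- The number of starting points in a block of length `L` whose quadratic coefficient,
multiplied by `v`, is close to an integer. -/
theorem card_near_int_leading_coeff_le {b L l R y n₀ : ℕ} {x D : ℝ} {v : ℤ} (hb : 0 < b)
    (hL : L = b ^ l) (hR : 0 < R) (hRL : R ^ 7 ≤ L) (hv : v ≠ 0) (hvR : |v| ≤ 6 * (R : ℤ) ^ 5)
    (hn₀ : Nat.Coprime n₀ b) (hn₀x : (n₀ : ℝ) ≤ x) (hD : 0 < D) (hy : D ≤ y)
    (h2 : 84 * x * (R : ℝ) ^ 13 ≤ D ^ 5) (u : ℕ → ℤ) (Z : Finset ℕ)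
    (hZ : ∀ d ∈ Z, y ≤ d ∧ d < y + L ∧ Nat.Coprime d b ∧ (L : ℤ) ∣ u d * d - 1 ∧
      ∃ k : ℤ, |v * n₀ * (1 / (d : ℝ) ^ 4 - u d ^ 4) / L - k| < 1 / (R : ℝ) ^ 2) :
    (Z.card : ℝ) ≤ 320 * b * L / R ^ 2 := by
  have hL0 : 0 < L := hL ▸ Nat.pow_pos hb
  have hR' : (0 : ℝ) < R := by exact_mod_cast hR
  have hR1 : (1 : ℝ) ≤ R := by exact_mod_cast hR
  have hx : 0 ≤ x := (Nat.cast_nonneg _).trans hn₀x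
  obtain ⟨g, v', L', hg, hv'L', hvg, hLg⟩ : ∃ (g : ℕ) (v' : ℤ) (L' : ℕ), 0 < g ∧
      IsCoprime v' L' ∧ v = g * v' ∧ L = g * L' := by
    have hg : 0 < Int.gcd v L := Int.gcd_pos_of_ne_zero_left _ hv
    obtain ⟨v', w, h, e1, e2⟩ := Int.exists_gcd_one hg
    have hw : 0 ≤ w := by
      by_contra! hneg
      have : (0 : ℤ) < L := by exact_mod_cast hL0
      have : (0 : ℤ) < (Int.gcd v L : ℤ) := by exact_mod_cast hg
      nlinarith
    lift w to ℕ using hw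
    refine ⟨Int.gcd v L, v', w, hg, Int.isCoprime_iff_gcd_eq_one.mpr h, by rw [mul_comm]; exact e1,
      ?_⟩
    have : (L : ℤ) = ((Int.gcd v L * w : ℕ) : ℤ) := by
      push_cast
      rw [mul_comm]
      exact e2
    exact_mod_cast this
  have hL'0 : 0 < L' := Nat.pos_of_mul_pos_left (hLg ▸ hL0)
  have hL'L : L' ∣ b ^ l := by rw [← hL, hLg]; exact dvd_mul_left _ _
  have hgv : (g : ℝ) ≤ 6 * R ^ 5 := by
    have h : (g : ℤ) ≤ |v| := Int.le_of_dvd (abs_pos.mpr hv) ((dvd_abs _ _).mpr ⟨v', hvg⟩)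
    exact_mod_cast h.trans hvR
  have hLR : (L : ℝ) = g * L' := by exact_mod_cast hLg
  have hvR' : (v : ℝ) = g * v' := by exact_mod_cast hvg
  have hg' : (0 : ℝ) < g := by exact_mod_cast hg
  have hL'' : (0 : ℝ) < L' := by exact_mod_cast hL'0
  have hLr : (0 : ℝ) < L := by exact_mod_cast hL0
  set β : ℝ := v * n₀ / (L * y ^ 4) with hβ
  have hex : ∀ d, ∃ k : ℤ, d ∈ Z →
      |v * n₀ * (1 / (d : ℝ) ^ 4 - u d ^ 4) / L - k| < 1 / (R : ℝ) ^ 2 := by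
    intro d
    by_cases hd : d ∈ Z
    · obtain ⟨-, -, -, -, k, hk⟩ := hZ d hd
      exact ⟨k, fun _ => hk⟩
    · exact ⟨0, fun h => absurd h hd⟩
  choose k hk using hex
  set W : ℕ → ℤ := fun d => v' * n₀ * u d ^ 4 + k d * L' with hW
  have hWclose : ∀ d ∈ Z, |(W d : ℝ) - L' * β| ≤ 2 * L' / (R : ℝ) ^ 2 := by
    intro d hd
    obtain ⟨hd1, hd2, -, -, -⟩ := hZ d hd
    have h3 := one_div_pow_four_sub_le (y := y) (d := d) (L := L) hD hy (by exact_mod_cast hd1)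
      (by exact_mod_cast hd2.le)
    have hvabs : |(v : ℝ)| ≤ 6 * R ^ 5 := by exact_mod_cast hvR
    have h4 : |v * n₀ / L * (1 / (d : ℝ) ^ 4 - 1 / (y : ℝ) ^ 4)| ≤ 1 / (R : ℝ) ^ 2 := by
      rw [abs_mul, abs_div, abs_mul, Nat.abs_cast, Nat.abs_cast]
      calc |(v : ℝ)| * n₀ / L * |1 / (d : ℝ) ^ 4 - 1 / (y : ℝ) ^ 4|
          ≤ 6 * R ^ 5 * x / L * (4 * L / D ^ 5) := by gcongr
        _ = 24 * x * R ^ 5 / D ^ 5 := by field_simp; ring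
        _ ≤ 1 / R ^ 2 := by
          rw [div_le_div_iff₀ (by positivity) (by positivity)]
          have : (R : ℝ) ^ 7 ≤ R ^ 13 := pow_le_pow_right₀ hR1 (by norm_num)
          have : x * (R : ℝ) ^ 7 ≤ x * R ^ 13 := by gcongr
          have : 0 ≤ x * (R : ℝ) ^ 13 := by positivity
          nlinarith
    have e : (W d : ℝ) - L' * β = L' * (v * n₀ / L * (1 / (d : ℝ) ^ 4 - 1 / (y : ℝ) ^ 4) -
        (v * n₀ * (1 / (d : ℝ) ^ 4 - u d ^ 4) / L - k d)) := by
      have hy0 : (y : ℝ) ≠ 0 := (hD.trans_le hy).ne'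
      have hd0 : (d : ℝ) ≠ 0 := by
        have : (y : ℝ) ≤ d := by exact_mod_cast hd1
        exact (hD.trans_le (hy.trans this)).ne'
      rw [hW, hβ, hLR, hvR']
      push_cast
      field_simp
      ring
    rw [e, abs_mul, Nat.abs_cast]
    calc _ ≤ L' * (1 / (R : ℝ) ^ 2 + 1 / R ^ 2) := by
          gcongr
          exact (abs_sub _ _).trans (add_le_add h4 (hk d hd).le)
      _ = _ := by ring
  have hfib : ∀ w ∈ Z.image W, (Z.filter fun d => W d = w).card ≤ 32 * b * g := by
    intro w _
    refine card_le_of_pow_four_congr (y := y) hb hL'L hL'0 _ ?_ ?_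
    · intro d hd
      obtain ⟨a1, a2, a3, -⟩ := hZ d (Finset.mem_filter.mp hd).1
      exact ⟨a1, hLg ▸ a2, a3⟩
    · intro d hd d' hd'
      obtain ⟨hd, hw⟩ := Finset.mem_filter.mp hd
      obtain ⟨hd', hw'⟩ := Finset.mem_filter.mp hd'
      obtain ⟨-, -, -, a4, -⟩ := hZ d hd
      obtain ⟨-, -, -, a4', -⟩ := hZ d' hd'
      have hLL : (L' : ℤ) ∣ L := by exact_mod_cast Dvd.intro_left g hLg.symm
      obtain ⟨p, hp⟩ := hLL.trans a4
      obtain ⟨p', hp'⟩ := hLL.trans a4'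
      have hcop : IsCoprime (L' : ℤ) (v' * n₀) := by
        refine hv'L'.symm.mul_right ?_
        have h5 : IsCoprime (n₀ : ℤ) ((b : ℤ) ^ l) :=
          (Nat.isCoprime_iff_coprime.mpr hn₀).pow_right
        exact (h5.of_isCoprime_of_dvd_right (by exact_mod_cast hL'L)).symm
      have h6 : (L' : ℤ) ∣ u d ^ 4 - u d' ^ 4 := by
        refine hcop.dvd_of_dvd_mul_left ⟨k d' - k d, ?_⟩
        have : W d = W d' := hw.trans hw'.symm
        simp only [hW] at this
        linarith
      have e1 : u d * d = 1 + L' * p := by linarith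
      have e2 : u d' * d' = 1 + L' * p' := by linarith
      have e3 : (d' : ℤ) ^ 4 - (d : ℤ) ^ 4 = (u d ^ 4 - u d' ^ 4) * (d ^ 4 * d' ^ 4) -
          (((u d * d) ^ 4 - 1) * d' ^ 4 - ((u d' * d') ^ 4 - 1) * d ^ 4) := by ring
      rw [e3, e1, e2]
      have e4 : ∀ p : ℤ, (L' : ℤ) ∣ (1 + L' * p) ^ 4 - 1 := fun p =>
        ⟨4 * p + 6 * L' * p ^ 2 + 4 * L' ^ 2 * p ^ 3 + L' ^ 3 * p ^ 4, by ring⟩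
      exact dvd_sub (h6.mul_right _) (dvd_sub ((e4 p).mul_right _) ((e4 p').mul_right _))
  have himg : ((Z.image W).card : ℝ) ≤ 4 * L' / R ^ 2 + 1 := by
    have hsub : Z.image W ⊆ Finset.Icc ⌈L' * β - 2 * L' / R ^ 2⌉ ⌊L' * β + 2 * L' / R ^ 2⌋ := by
      intro w hw
      obtain ⟨d, hd, rfl⟩ := Finset.mem_image.mp hw
      have := abs_le.mp (hWclose d hd)
      rw [Finset.mem_Icc, Int.ceil_le, Int.le_floor]
      constructor <;> linarith
    have h7 := Finset.card_le_card hsub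
    rw [Int.card_Icc] at h7
    have h8 : ((Z.image W).card : ℝ) ≤
        (((⌊L' * β + 2 * L' / R ^ 2⌋ + 1 - ⌈L' * β - 2 * L' / R ^ 2⌉).toNat : ℕ) : ℝ) := by
      exact_mod_cast h7
    refine h8.trans ?_
    have h9 : (0 : ℝ) ≤ 2 * L' / R ^ 2 := by positivity
    have h10 := Int.floor_le (L' * β + 2 * L' / R ^ 2)
    have h11 := Int.le_ceil (L' * β - 2 * L' / R ^ 2)
    have e : 4 * (L' : ℝ) / R ^ 2 = 2 * (2 * L' / R ^ 2) := by ring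
    rw [e]
    rcases le_total 0 (⌊L' * β + 2 * L' / R ^ 2⌋ + 1 - ⌈L' * β - 2 * L' / R ^ 2⌉) with h | h
    · have : (((⌊L' * β + 2 * L' / R ^ 2⌋ + 1 - ⌈L' * β - 2 * L' / R ^ 2⌉).toNat : ℕ) : ℝ) =
          ((⌊L' * β + 2 * L' / R ^ 2⌋ + 1 - ⌈L' * β - 2 * L' / R ^ 2⌉ : ℤ) : ℝ) := by
        exact_mod_cast Int.toNat_of_nonneg h
      rw [this]
      push_cast
      linarith
    · rw [Int.toNat_of_nonpos h]
      push_cast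
      linarith
  have htot : (Z.card : ℝ) ≤ (32 * b * g : ℕ) * (Z.image W).card := by
    exact_mod_cast Finset.card_le_mul_card_image Z _ hfib
  have hb' : (0 : ℝ) < b := by exact_mod_cast hb
  have hRL' : (R : ℝ) ^ 7 ≤ L := by exact_mod_cast hRL
  calc (Z.card : ℝ) ≤ (32 * b * g : ℕ) * (Z.image W).card := htot
    _ ≤ (32 * b * g : ℕ) * (4 * L' / R ^ 2 + 1) := by gcongr
    _ = 128 * b * (g * L') / R ^ 2 + 32 * b * g := by push_cast; ring
    _ ≤ 128 * b * (g * L') / R ^ 2 + 32 * b * (6 * L / R ^ 2) := by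
      gcongr
      refine hgv.trans ?_
      rw [le_div_iff₀ (by positivity)]
      linarith
    _ = 320 * b * L / R ^ 2 := by rw [← hLR]; ring

/-- Average bound for the Weyl sums attached to the starting points of a block. -/
theorem sum_norm_weyl_sum_le {b L l R y n₀ : ℕ} {x D : ℝ} {j : ℤ} (hb : 0 < b)
    (hL : L = b ^ l) (hR : 0 < R) (hRL : R ^ 7 ≤ L) (hj : j ≠ 0) (hjR : |j| ≤ R)
    (hn₀ : Nat.Coprime n₀ b) (hn₀x : (n₀ : ℝ) ≤ x) (hD : 0 < D) (hy : D ≤ y)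
    (h2 : 84 * x * (R : ℝ) ^ 13 ≤ D ^ 5) (u : ℕ → ℤ) (β γ : ℕ → ℝ) (Z : Finset ℕ)
    (hZ : ∀ d ∈ Z, y ≤ d ∧ d < y + L ∧ Nat.Coprime d b ∧ (L : ℤ) ∣ u d * d - 1) :
    ∑ d ∈ Z, ‖∑ t ∈ Finset.range (R ^ 4), unitExp (j * (γ d + β d * t +
      3 * n₀ * (1 / (d : ℝ) ^ 4 - u d ^ 4) / L * (t : ℝ) ^ 2))‖ ≤ 26 * b * L * R ^ 3 := by
  have hL0 : 0 < L := hL ▸ Nat.pow_pos hb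
  have hR' : (0 : ℝ) < R := by exact_mod_cast hR
  have hR1 : (1 : ℝ) ≤ R := by exact_mod_cast hR
  have hb1 : (1 : ℝ) ≤ b := by exact_mod_cast hb
  have hLr : (0 : ℝ) < L := by exact_mod_cast hL0
  have hcard : (Z.card : ℝ) ≤ L := by
    have : Z ⊆ Finset.Ico y (y + L) := fun d hd =>
      Finset.mem_Ico.mpr ⟨(hZ d hd).1, (hZ d hd).2.1⟩
    have := Finset.card_le_card this
    rw [Nat.card_Ico, Nat.add_sub_cancel_left] at this
    exact_mod_cast this
  set a : ℕ → ℝ := fun d => j * (3 * n₀ * (1 / (d : ℝ) ^ 4 - u d ^ 4) / L) with ha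
  set S : ℕ → ℝ := fun d => ‖∑ t ∈ Finset.range (R ^ 4), unitExp (j * (γ d + β d * t +
      3 * n₀ * (1 / (d : ℝ) ^ 4 - u d ^ 4) / L * (t : ℝ) ^ 2))‖ with hS
  have hweyl : ∀ d, S d ^ 2 ≤ 2 * ∑ h ∈ Finset.range (R ^ 4),
      ‖∑ t ∈ Finset.range (R ^ 4 - h), unitExp (2 * a d * h * t)‖ := by
    intro d
    refine le_trans (le_of_eq ?_)
      (norm_sq_sum_unitExp_quadratic_le (a d) (j * β d) (j * γ d) (R ^ 4))
    simp only [hS, ha]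
    congr 3
    ext t
    congr 1
    ring
  have hinner : ∀ h ∈ Finset.range (R ^ 4),
      ∑ d ∈ Z, ‖∑ t ∈ Finset.range (R ^ 4 - h), unitExp (2 * a d * h * t)‖ ≤
        (if h = 0 then (L : ℝ) * R ^ 4 else 0) + 321 * b * L * R ^ 2 := by
    intro h hh
    have hhR : h < R ^ 4 := Finset.mem_range.mp hh
    have htriv : ∀ d, ‖∑ t ∈ Finset.range (R ^ 4 - h), unitExp (2 * a d * h * t)‖ ≤
        (R : ℝ) ^ 4 := by
      intro d
      refine (norm_sum_unitExp_le_card (fun t => 2 * a d * h * t) _).trans ?_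
      exact_mod_cast Nat.sub_le _ _
    split_ifs with h0
    · have : ∑ d ∈ Z, ‖∑ t ∈ Finset.range (R ^ 4 - h), unitExp (2 * a d * h * t)‖ ≤
          Z.card • (R : ℝ) ^ 4 := Finset.sum_le_card_nsmul _ _ _ fun d _ => htriv d
      rw [nsmul_eq_mul] at this
      have h3 : (Z.card : ℝ) * R ^ 4 ≤ L * R ^ 4 := by gcongr
      have : (0 : ℝ) ≤ 321 * b * L * R ^ 2 := by positivity
      linarith
    · classical
      set bad := Z.filter fun d => ∃ k : ℤ, |2 * a d * h - k| < 1 / (R : ℝ) ^ 2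
      have hbad : (bad.card : ℝ) ≤ 320 * b * L / R ^ 2 := by
        refine card_near_int_leading_coeff_le (v := 6 * j * h) (n₀ := n₀) (x := x) (D := D)
          (y := y) hb hL hR hRL ?_ ?_ hn₀ hn₀x hD hy h2 u bad ?_
        · have : (h : ℤ) ≠ 0 := by exact_mod_cast h0
          positivity
        · rw [abs_mul, abs_mul, Nat.abs_cast]
          have : (h : ℤ) ≤ (R : ℤ) ^ 4 := by exact_mod_cast hhR.le
          calc |(6 : ℤ)| * |j| * h ≤ 6 * R * (R : ℤ) ^ 4 := by
                gcongr
                norm_num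
            _ = 6 * (R : ℤ) ^ 5 := by ring
        · intro d hd
          obtain ⟨hd, k, hk⟩ := Finset.mem_filter.mp hd
          obtain ⟨a1, a2, a3, a4⟩ := hZ d hd
          refine ⟨a1, a2, a3, a4, k, ?_⟩
          convert hk using 3
          simp only [ha]
          push_cast
          ring
      have hterm : ∀ d ∈ Z, ‖∑ t ∈ Finset.range (R ^ 4 - h), unitExp (2 * a d * h * t)‖ ≤
          (R : ℝ) ^ 2 + (if ∃ k : ℤ, |2 * a d * h - k| < 1 / (R : ℝ) ^ 2
            then (R : ℝ) ^ 4 else 0) := by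
        intro d _
        split_ifs with hk
        · have := htriv d
          have : (0 : ℝ) ≤ R ^ 2 := by positivity
          linarith
        · push Not at hk
          refine (norm_sum_unitExp_le (by positivity) hk _).trans ?_
          rw [add_zero]
          have : 1 / (2 * (1 / (R : ℝ) ^ 2)) = R ^ 2 / 2 := by field_simp
          rw [this]
          exact half_le_self (by positivity)
      refine (Finset.sum_le_sum hterm).trans ?_
      rw [Finset.sum_add_distrib, ← Finset.sum_filter, Finset.sum_const, Finset.sum_const,
        nsmul_eq_mul, nsmul_eq_mul, zero_add]
      have hbad' : (bad.card : ℝ) * (R : ℝ) ^ 4 ≤ 320 * b * L * (R : ℝ) ^ 2 := by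
        calc (bad.card : ℝ) * (R : ℝ) ^ 4 ≤ 320 * b * L / (R : ℝ) ^ 2 * (R : ℝ) ^ 4 := by gcongr
          _ = 320 * b * L * (R : ℝ) ^ 2 := by field_simp
      have hgood : (Z.card : ℝ) * (R : ℝ) ^ 2 ≤ b * (L * (R : ℝ) ^ 2) := by
        refine le_trans ?_ (le_mul_of_one_le_left (by positivity) hb1)
        gcongr
      linarith
  have hsq : ∑ d ∈ Z, S d ^ 2 ≤ 644 * b * L * R ^ 6 := by
    calc ∑ d ∈ Z, S d ^ 2 ≤ ∑ d ∈ Z, 2 * ∑ h ∈ Finset.range (R ^ 4),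
          ‖∑ t ∈ Finset.range (R ^ 4 - h), unitExp (2 * a d * h * t)‖ :=
          Finset.sum_le_sum fun d _ => hweyl d
      _ = 2 * ∑ h ∈ Finset.range (R ^ 4), ∑ d ∈ Z,
          ‖∑ t ∈ Finset.range (R ^ 4 - h), unitExp (2 * a d * h * t)‖ := by
        rw [← Finset.mul_sum, Finset.sum_comm]
      _ ≤ 2 * ∑ h ∈ Finset.range (R ^ 4),
          ((if h = 0 then (L : ℝ) * R ^ 4 else 0) + 321 * b * L * R ^ 2) :=
          mul_le_mul_of_nonneg_left (Finset.sum_le_sum hinner) zero_le_two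
      _ = 2 * (L * R ^ 4 + 321 * b * L * R ^ 6) := by
        rw [Finset.sum_add_distrib, Finset.sum_ite_eq', if_pos (by simp [hR]), Finset.sum_const,
          Finset.card_range, nsmul_eq_mul]
        push_cast
        ring
      _ ≤ 2 * (b * L * R ^ 6 + 321 * b * L * R ^ 6) := by
        gcongr ?_ * (?_ * ?_ + _)
        · exact le_mul_of_one_le_left hLr.le hb1
        · exact pow_le_pow_right₀ hR1 (by norm_num)
      _ = _ := by ring
  refine abs_le_of_sq_le_sq' ?_ (by positivity) |>.2
  calc (∑ d ∈ Z, S d) ^ 2 ≤ Z.card * ∑ d ∈ Z, S d ^ 2 := sq_sum_le_card_mul_sum_sq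
    _ ≤ L * (644 * b * L * R ^ 6) := by
      refine mul_le_mul hcard hsq (Finset.sum_nonneg fun _ _ => by positivity) hLr.le
    _ = 644 * b * (L ^ 2 * R ^ 6) := by ring
    _ ≤ 676 * b ^ 2 * (L ^ 2 * R ^ 6) := by
      gcongr ?_ * _
      nlinarith
    _ = (26 * b * L * R ^ 3) ^ 2 := by ring

/-- Bound for the divisors in a block of length `R ^ 4 * L`. -/
theorem card_block_le {b L l R y n₀ : ℕ} {x D : ℝ} (hb : 0 < b)
    (hL : L = b ^ l) (hl : 0 < l) (hR : 0 < R) (hRL : R ^ 7 ≤ L)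
    (hn₀ : Nat.Coprime n₀ b) (hn₀x : (n₀ : ℝ) ≤ x) (hD : 0 < D) (hy : D ≤ y)
    (hTL : (R : ℝ) ^ 4 * L ≤ D)
    (h1 : 12 * b * x * R ≤ (L : ℝ) ^ 6 * D ^ 2) (h2 : 84 * x * (R : ℝ) ^ 13 ≤ D ^ 5)
    (A : Finset ℕ) (hA : ∀ d ∈ A, y ≤ d ∧ d < y + R ^ 4 * L ∧ Nat.Coprime d b ∧
      ∃ m : ℤ, (L : ℤ) ^ 3 ∣ (d : ℤ) ^ 2 * m - n₀ ∧
        |(d : ℝ) ^ 2 * m - n₀| * L ^ 3 ≤ b * x) :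
    (A.card : ℝ) ≤ 108 * b * L * R ^ 3 := by
  classical
  have hL0 : 0 < L := hL ▸ Nat.pow_pos hb
  have hR' : (0 : ℝ) < R := by exact_mod_cast hR
  have hR1 : (1 : ℝ) ≤ R := by exact_mod_cast hR
  have hb1 : (1 : ℝ) ≤ b := by exact_mod_cast hb
  have hLr : (0 : ℝ) < L := by exact_mod_cast hL0
  have hinv : ∀ d : ℕ, ∃ u : ℤ, Nat.Coprime d b → (L : ℤ) ^ 3 ∣ u * d - 1 := by
    intro d
    by_cases hd : Nat.Coprime d b
    · have : IsCoprime (d : ℤ) ((L : ℤ) ^ 3) := by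
        rw [hL]
        push_cast
        exact ((Nat.isCoprime_iff_coprime.mpr hd).pow_right).pow_right
      obtain ⟨u, w, h⟩ := this
      exact ⟨u, fun _ => ⟨-w, by linarith⟩⟩
    · exact ⟨0, fun h => absurd h hd⟩
  choose u hu using hinv
  set Z := (Finset.Ico y (y + L)).filter fun d => Nat.Coprime d b with hZdef
  have hZ : ∀ d ∈ Z, y ≤ d ∧ d < y + L ∧ Nat.Coprime d b ∧ (L : ℤ) ∣ u d * d - 1 := by
    intro d hd
    obtain ⟨hd1, hd2⟩ := Finset.mem_filter.mp hd
    obtain ⟨hd3, hd4⟩ := Finset.mem_Ico.mp hd1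
    exact ⟨hd3, hd4, hd2, (dvd_pow_self _ three_ne_zero).trans (hu d hd2)⟩
  set G : ℕ → Finset ℕ := fun d => (Finset.range (R ^ 4)).filter fun t => d + L * t ∈ A with hG
  have hcover : A ⊆ Z.biUnion fun d => (G d).image fun t => d + L * t := by
    intro d hd
    obtain ⟨a1, a2, a3, -⟩ := hA d hd
    have e : y + (d - y) % L + L * ((d - y) / L) = d := by
      have := Nat.mod_add_div (d - y) L
      omega
    have hco : Nat.Coprime (y + (d - y) % L) b := by
      have : d = y + (d - y) % L + b * (b ^ (l - 1) * ((d - y) / L)) := by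
        rw [← mul_assoc, ← pow_succ', Nat.sub_add_cancel hl, ← hL]
        exact e.symm
      rw [this] at a3
      simpa using a3
    refine Finset.mem_biUnion.mpr ⟨y + (d - y) % L, ?_, Finset.mem_image.mpr
      ⟨(d - y) / L, ?_, e⟩⟩
    · refine Finset.mem_filter.mpr ⟨Finset.mem_Ico.mpr ⟨by omega, ?_⟩, hco⟩
      have := Nat.mod_lt (d - y) hL0
      omega
    · refine Finset.mem_filter.mpr ⟨Finset.mem_range.mpr ?_, by rwa [e]⟩
      rw [Nat.div_lt_iff_lt_mul hL0]
      omega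
  have hAcard : (A.card : ℝ) ≤ ∑ d ∈ Z, ((G d).card : ℝ) := by
    have h3 : A.card ≤ ∑ d ∈ Z, (G d).card :=
      (Finset.card_le_card hcover).trans (Finset.card_biUnion_le.trans
        (Finset.sum_le_sum fun _ _ => Finset.card_image_le))
    exact_mod_cast h3
  set γ : ℕ → ℝ := fun d => n₀ * (1 / (d : ℝ) ^ 4 - u d ^ 4) / L ^ 3 * d ^ 2 with hγ
  set β : ℕ → ℝ := fun d => -(2 * d * (n₀ * (1 / (d : ℝ) ^ 4 - u d ^ 4) / L ^ 2)) with hβ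
  have hFejer : ∀ d ∈ Z, ((G d).card : ℝ) * R ^ 2 ≤
      4 * ∑ r ∈ Finset.range R, ∑ s ∈ Finset.range R, ‖∑ t ∈ Finset.range (R ^ 4),
        unitExp (((r : ℤ) - (s : ℤ) : ℤ) * (γ d + β d * t +
          3 * n₀ * (1 / (d : ℝ) ^ 4 - u d ^ 4) / L * (t : ℝ) ^ 2))‖ := by
    intro d hd
    refine card_near_int_mul_sq_le (fun t => γ d + β d * t +
      3 * n₀ * (1 / (d : ℝ) ^ 4 - u d ^ 4) / L * (t : ℝ) ^ 2) (R ^ 4) R hR (G d) ?_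
    intro t ht
    obtain ⟨ht, htA⟩ := Finset.mem_filter.mp ht
    have ht := Finset.mem_range.mp ht
    obtain ⟨hd1, -, hd3, -⟩ := hZ d hd
    obtain ⟨-, -, -, m, hm1, hm2⟩ := hA _ htA
    have hyd : (y : ℝ) ≤ d := by exact_mod_cast hd1
    refine ⟨ht, ?_⟩
    have := exists_int_near_quadratic (n₀ := n₀) (m := m) (u := u d) (b := b) hL0 hR hD
      (hy.trans hyd) ht hTL (by positivity) (by exact_mod_cast hn₀x) h1 h2 (hu d hd3) hm1
      (by exact_mod_cast hm2)
    simpa [hγ, hβ] using this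
  have hZcard : (Z.card : ℝ) ≤ L := by
    have := (Finset.card_filter_le (Finset.Ico y (y + L)) fun d => Nat.Coprime d b)
    rw [Nat.card_Ico, Nat.add_sub_cancel_left] at this
    exact_mod_cast this
  have hpair : ∀ r ∈ Finset.range R, ∀ s ∈ Finset.range R,
      ∑ d ∈ Z, ‖∑ t ∈ Finset.range (R ^ 4),
        unitExp (((r : ℤ) - (s : ℤ) : ℤ) * (γ d + β d * t +
          3 * n₀ * (1 / (d : ℝ) ^ 4 - u d ^ 4) / L * (t : ℝ) ^ 2))‖ ≤
      (if s = r then (L : ℝ) * R ^ 4 else 0) + 26 * b * L * R ^ 3 := by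
    intro r hr s hs
    rw [Finset.mem_range] at hr hs
    split_ifs with hrs
    · have : ∀ d ∈ Z, ‖∑ t ∈ Finset.range (R ^ 4),
          unitExp (((r : ℤ) - (s : ℤ) : ℤ) * (γ d + β d * t +
          3 * n₀ * (1 / (d : ℝ) ^ 4 - u d ^ 4) / L * (t : ℝ) ^ 2))‖ ≤ (R : ℝ) ^ 4 := by
        intro d _
        refine (norm_sum_unitExp_le_card _ _).trans (le_of_eq ?_)
        push_cast
        rfl
      refine (Finset.sum_le_card_nsmul _ _ _ this).trans ?_
      rw [nsmul_eq_mul]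
      have h3 : (Z.card : ℝ) * R ^ 4 ≤ L * R ^ 4 := by gcongr
      have : (0 : ℝ) ≤ 26 * b * L * R ^ 3 := by positivity
      linarith
    · rw [zero_add]
      exact sum_norm_weyl_sum_le hb hL hR hRL (by omega) (by rw [abs_le]; omega) hn₀ hn₀x hD hy h2
        u β γ Z hZ
  have htotal : (∑ d ∈ Z, ((G d).card : ℝ)) * R ^ 2 ≤ 108 * b * L * R ^ 3 * R ^ 2 := by
    rw [Finset.sum_mul]
    refine (Finset.sum_le_sum hFejer).trans ?_
    rw [← Finset.mul_sum, Finset.sum_comm]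
    calc _ = 4 * ∑ r ∈ Finset.range R, ∑ s ∈ Finset.range R, ∑ d ∈ Z,
          ‖∑ t ∈ Finset.range (R ^ 4),
          unitExp (((r : ℤ) - (s : ℤ) : ℤ) * (γ d + β d * t +
          3 * n₀ * (1 / (d : ℝ) ^ 4 - u d ^ 4) / L * (t : ℝ) ^ 2))‖ := by
          congr 1
          exact Finset.sum_congr rfl fun r _ => Finset.sum_comm
      _ ≤ 4 * ∑ r ∈ Finset.range R, ∑ s ∈ Finset.range R,
          ((if s = r then (L : ℝ) * R ^ 4 else 0) + 26 * b * L * R ^ 3) := by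
          gcongr with r hr s hs
          exact hpair r hr s hs
      _ = 4 * ∑ r ∈ Finset.range R, ((L : ℝ) * R ^ 4 + 26 * b * L * R ^ 4) := by
          congr 1
          refine Finset.sum_congr rfl fun r hr => ?_
          rw [Finset.sum_add_distrib, Finset.sum_ite_eq', if_pos hr, Finset.sum_const,
            Finset.card_range, nsmul_eq_mul]
          ring
      _ = 4 * L * R ^ 5 + 104 * b * L * R ^ 5 := by
          rw [Finset.sum_const, Finset.card_range, nsmul_eq_mul]
          ring
      _ ≤ 4 * (b * L) * R ^ 5 + 104 * b * L * R ^ 5 := by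
          gcongr
          exact le_mul_of_one_le_left hLr.le hb1
      _ = _ := by ring
  exact hAcard.trans (le_of_mul_le_mul_right htotal (by positivity))

/-- Bound for the divisors in a dyadic range. -/
theorem card_dyadic_le {b L l R n₀ : ℕ} {x D : ℝ} (hb : 0 < b)
    (hL : L = b ^ l) (hl : 0 < l) (hR : 0 < R) (hRL : R ^ 7 ≤ L)
    (hn₀ : Nat.Coprime n₀ b) (hn₀x : (n₀ : ℝ) ≤ x) (hD : 0 < D)
    (hTL : (R : ℝ) ^ 4 * L ≤ D)
    (h1 : 12 * b * x * R ≤ (L : ℝ) ^ 6 * D ^ 2) (h2 : 84 * x * (R : ℝ) ^ 13 ≤ D ^ 5)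
    (A : Finset ℕ) (hA : ∀ d ∈ A, D ≤ d ∧ (d : ℝ) ≤ 2 * D ∧ Nat.Coprime d b ∧
      ∃ m : ℤ, (L : ℤ) ^ 3 ∣ (d : ℤ) ^ 2 * m - n₀ ∧
        |(d : ℝ) ^ 2 * m - n₀| * L ^ 3 ≤ b * x) :
    (A.card : ℝ) ≤ 216 * b * D / R := by
  classical
  have hL0 : 0 < L := hL ▸ Nat.pow_pos hb
  have hR' : (0 : ℝ) < R := by exact_mod_cast hR
  have hLr : (0 : ℝ) < L := by exact_mod_cast hL0
  set H := R ^ 4 * L with hH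
  have hH0 : 0 < H := by positivity
  have hHr : (H : ℝ) = R ^ 4 * L := by rw [hH]; push_cast; rfl
  have hf : ∀ d ∈ A, (d - ⌈D⌉₊) / H ∈ Finset.range (⌊D / H⌋₊ + 1) := by
    intro d hd
    obtain ⟨a1, a2, -⟩ := hA d hd
    rw [Finset.mem_range, Nat.lt_succ_iff]
    refine Nat.le_floor ?_
    refine Nat.cast_div_le.trans ?_
    gcongr
    rw [Nat.cast_sub (Nat.ceil_le.mpr a1)]
    have := Nat.le_ceil D
    linarith
  have hfib : ∀ i ∈ Finset.range (⌊D / H⌋₊ + 1),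
      ((A.filter fun d => (d - ⌈D⌉₊) / H = i).card : ℝ) ≤ 108 * b * L * R ^ 3 := by
    intro i _
    refine card_block_le (y := ⌈D⌉₊ + H * i) hb hL hl hR hRL hn₀ hn₀x hD ?_ hTL h1 h2 _ ?_
    · push_cast
      have := Nat.le_ceil D
      have : (0 : ℝ) ≤ H * i := by positivity
      linarith
    · intro d hd
      obtain ⟨hd, hi⟩ := Finset.mem_filter.mp hd
      obtain ⟨a1, a2, a3⟩ := hA d hd
      have a4 : ⌈D⌉₊ ≤ d := Nat.ceil_le.mpr a1
      have a5 := Nat.mod_add_div (d - ⌈D⌉₊) H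
      have a6 := Nat.mod_lt (d - ⌈D⌉₊) hH0
      rw [hi] at a5
      refine ⟨?_, ?_, a3⟩ <;> omega
  have h3 : (A.card : ℝ) ≤ ∑ i ∈ Finset.range (⌊D / H⌋₊ + 1),
      ((A.filter fun d => (d - ⌈D⌉₊) / H = i).card : ℝ) := by
    rw [Finset.card_eq_sum_card_fiberwise hf]
    push_cast
    rfl
  have h4 := h3.trans (Finset.sum_le_card_nsmul _ _ _ hfib)
  rw [Finset.card_range, nsmul_eq_mul] at h4
  refine h4.trans ?_
  have h5 : ((⌊D / H⌋₊ + 1 : ℕ) : ℝ) ≤ 2 * (D / H) := by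
    have := Nat.floor_le (show 0 ≤ D / H by positivity)
    have h6 : 1 ≤ D / H := by
      rw [le_div_iff₀ (by positivity), one_mul, hHr]
      exact hTL
    push_cast
    linarith
  calc _ ≤ 2 * (D / H) * (108 * b * L * R ^ 3) := by gcongr
    _ = 216 * b * D / R := by
      rw [hHr]
      field_simp
      norm_num

/-- Palindromes of equal length which agree in the last `k` digits agree in the first `k`. -/
theorem IsBPalindrome.abs_sub_mul_pow_le {b n₁ n₂ k : ℕ} (hb : 2 ≤ b) (h₁ : IsBPalindrome b n₁)
    (h₂ : IsBPalindrome b n₂) (hlen : (Nat.digits b n₁).length = (Nat.digits b n₂).length)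
    (hmod : n₁ % b ^ k = n₂ % b ^ k) :
    |(n₁ : ℤ) - n₂| * (b : ℤ) ^ k ≤ b * n₁ := by
  have hn₁ : n₁ ≠ 0 := fun h => h₁.1 (h ▸ dvd_zero b)
  have hlt₁ : n₁ < b ^ (Nat.digits b n₁).length := Nat.lt_base_pow_length_digits hb
  have hlt₂ : n₂ < b ^ (Nat.digits b n₁).length := hlen ▸ Nat.lt_base_pow_length_digits hb
  rcases le_total (Nat.digits b n₁).length k with hk | hk
  · have hpow : b ^ (Nat.digits b n₁).length ≤ b ^ k := Nat.pow_le_pow_right (by omega) hk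
    rw [Nat.mod_eq_of_lt (hlt₁.trans_le hpow), Nat.mod_eq_of_lt (hlt₂.trans_le hpow)] at hmod
    rw [hmod, sub_self, abs_zero, zero_mul]
    positivity
  · rw [Nat.self_mod_pow_eq_ofDigits_take _ _ hb, Nat.self_mod_pow_eq_ofDigits_take _ _ hb] at hmod
    have htake : (Nat.digits b n₁).take k = (Nat.digits b n₂).take k :=
      Nat.ofDigits_inj_of_len_eq hb (by simp [hlen])
        (fun d hd => Nat.digits_lt_base hb (List.mem_of_mem_take hd))
        (fun d hd => Nat.digits_lt_base hb (List.mem_of_mem_take hd)) hmod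
    have hdrop : ∀ n, IsBPalindrome b n →
        (Nat.digits b n).drop ((Nat.digits b n).length - k) =
          ((Nat.digits b n).take k).reverse := by
      intro n hn
      have := List.take_reverse (xs := Nat.digits b n) (i := k)
      rw [hn.2.reverse_eq] at this
      rw [this, List.reverse_reverse]
    have hdiv : n₁ / b ^ ((Nat.digits b n₁).length - k) =
        n₂ / b ^ ((Nat.digits b n₁).length - k) := by
      rw [Nat.self_div_pow_eq_ofDigits_drop _ _ hb, Nat.self_div_pow_eq_ofDigits_drop _ _ hb,
        hdrop n₁ h₁, hlen, hdrop n₂ h₂, htake]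
    have hlt : |(n₁ : ℤ) - n₂| < (b : ℤ) ^ ((Nat.digits b n₁).length - k) := by
      have e₁ := Nat.div_add_mod n₁ (b ^ ((Nat.digits b n₁).length - k))
      have e₂ := Nat.div_add_mod n₂ (b ^ ((Nat.digits b n₁).length - k))
      rw [← hdiv] at e₂
      have hpos : 0 < b ^ ((Nat.digits b n₁).length - k) := Nat.pow_pos (by omega)
      have m₁ := Nat.mod_lt n₁ hpos
      have m₂ := Nat.mod_lt n₂ hpos
      rw [abs_lt]
      zify at *
      constructor <;> linarith [Int.emod_nonneg (n₁ : ℤ) hpos.ne', Int.emod_nonneg (n₂ : ℤ) hpos.ne']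
    calc |(n₁ : ℤ) - n₂| * (b : ℤ) ^ k
        ≤ (b : ℤ) ^ ((Nat.digits b n₁).length - k) * (b : ℤ) ^ k := by gcongr
      _ = (b : ℤ) ^ (Nat.digits b n₁).length := by rw [← pow_add, Nat.sub_add_cancel hk]
      _ ≤ b * n₁ := by exact_mod_cast Nat.base_pow_length_digits_le b n₁ hb hn₁

/-- Splitting a set of palindromes into clusters of close and congruent elements. -/
theorem card_le_of_forall_cluster {b k M : ℕ} {B : ℝ} (hb : 2 ≤ b) (S : Finset ℕ)
    (hS : ∀ n ∈ S, IsBPalindrome b n ∧ n ≤ M)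
    (hB : ∀ A ⊆ S, (∀ n₁ ∈ A, ∀ n₂ ∈ A, (b : ℤ) ^ k ∣ (n₁ : ℤ) - n₂ ∧
      |(n₁ : ℤ) - n₂| * (b : ℤ) ^ k ≤ b * n₁) → (A.card : ℝ) ≤ B) :
    (S.card : ℝ) ≤ (Nat.log b M + 1) * (b : ℝ) ^ k * B := by
  classical
  let f : ℕ → ℕ × ℕ := fun n => (Nat.log b n, n % b ^ k)
  have hmaps : ∀ n ∈ S, f n ∈ Finset.range (Nat.log b M + 1) ×ˢ Finset.range (b ^ k) := by
    intro n hn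
    simp only [f, Finset.mem_product, Finset.mem_range]
    exact ⟨Nat.lt_succ_of_le (Nat.log_mono_right (hS n hn).2),
      Nat.mod_lt _ (Nat.pow_pos (by omega))⟩
  rw [Finset.card_eq_sum_card_fiberwise hmaps, Nat.cast_sum]
  refine (Finset.sum_le_card_nsmul _ _ B fun c _ => hB _ (Finset.filter_subset _ _) ?_).trans
    (le_of_eq ?_)
  · intro n₁ hn₁ n₂ hn₂
    obtain ⟨hn₁, e₁⟩ := Finset.mem_filter.mp hn₁
    obtain ⟨hn₂, e₂⟩ := Finset.mem_filter.mp hn₂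
    have h₁ := (hS n₁ hn₁).1
    have h₂ := (hS n₂ hn₂).1
    have he : f n₁ = f n₂ := e₁.trans e₂.symm
    have hlog : Nat.log b n₁ = Nat.log b n₂ := congrArg Prod.fst he
    have hmod : n₁ % b ^ k = n₂ % b ^ k := congrArg Prod.snd he
    refine ⟨?_, h₁.abs_sub_mul_pow_le hb h₂ ?_ hmod⟩
    · have := (Nat.modEq_iff_dvd.mp (Nat.ModEq.symm hmod))
      exact_mod_cast this
    · have hne : ∀ n, IsBPalindrome b n → n ≠ 0 := fun n hn h => hn.1 (h ▸ dvd_zero b)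
      rw [Nat.length_digits _ _ hb (hne n₁ h₁), Nat.length_digits _ _ hb (hne n₂ h₂), hlog]
  · simp

/-- Bound for a cluster when the modulus is large compared to `D`. -/
theorem card_cluster_le_of_dyadic {b l R : ℕ} {x D : ℝ} (hb : 2 ≤ b) (hl : 0 < l) (hR : 0 < R)
    (hRL : R ^ 7 ≤ b ^ l) (hx : 1 ≤ x) (hD : 0 < D) (hTL : (R : ℝ) ^ 4 * (b : ℝ) ^ l ≤ D)
    (h1 : 12 * b * x * R ≤ ((b : ℝ) ^ l) ^ 6 * D ^ 2) (h2 : 84 * x * (R : ℝ) ^ 13 ≤ D ^ 5)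
    (A : Finset ℕ) (hA : ∀ n ∈ A, (n : ℝ) ≤ x ∧ Nat.Coprime n b ∧
      ∃ d : ℕ, D ≤ (d : ℝ) ∧ (d : ℝ) ≤ 2 * D ∧ d ^ 2 ∣ n)
    (hA' : ∀ n₁ ∈ A, ∀ n₂ ∈ A, (b : ℤ) ^ (l * 3) ∣ (n₁ : ℤ) - n₂ ∧
      |(n₁ : ℤ) - n₂| * (b : ℤ) ^ (l * 3) ≤ b * n₁) :
    (A.card : ℝ) ≤ 216 * b * D / R := by
  classical
  rcases A.eq_empty_or_nonempty with rfl | ⟨n₀, hn₀⟩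
  · simp only [Finset.card_empty, Nat.cast_zero]
    positivity
  choose! d hd using fun n hn => (hA n hn).2.2
  have hb0 : (0 : ℝ) < b := by exact_mod_cast (by omega : 0 < b)
  have hR1 : (1 : ℝ) ≤ R := by exact_mod_cast hR
  have hdiff : ∀ n₁ ∈ A, ∀ n₂ ∈ A, |(n₁ : ℝ) - n₂| * ((b : ℝ) ^ l) ^ 3 ≤ b * x := by
    intro n₁ h₁ n₂ h₂
    have := (hA' n₁ h₁ n₂ h₂).2
    have h' : |(n₁ : ℝ) - n₂| * (b : ℝ) ^ (l * 3) ≤ b * n₁ := by exact_mod_cast this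
    rw [pow_mul] at h'
    exact h'.trans (by gcongr; exact (hA n₁ h₁).1)
  have hinj : Set.InjOn d A := by
    intro n₁ h₁ n₂ h₂ he
    by_contra hne
    have hdvd : (d n₁ : ℤ) ^ 2 * (b : ℤ) ^ (l * 3) ∣ (n₁ : ℤ) - n₂ := by
      refine IsCoprime.mul_dvd ?_ ?_ (hA' n₁ h₁ n₂ h₂).1
      · have : Nat.Coprime (d n₁ ^ 2) b := Nat.Coprime.coprime_dvd_left (hd n₁ h₁).2.2 (hA n₁ h₁).2.1
        exact_mod_cast (Nat.isCoprime_iff_coprime.mpr (this.pow_right (l * 3)))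
      · refine dvd_sub (by exact_mod_cast (hd n₁ h₁).2.2) ?_
        rw [he]
        exact_mod_cast (hd n₂ h₂).2.2
    have hle := Int.le_of_dvd (abs_pos.mpr (sub_ne_zero.mpr (by exact_mod_cast hne)))
      ((dvd_abs _ _).mpr hdvd)
    have hle' : (d n₁ : ℝ) ^ 2 * ((b : ℝ) ^ l) ^ 3 ≤ |(n₁ : ℝ) - n₂| := by
      rw [← pow_mul]
      exact_mod_cast hle
    have h3 := hdiff n₁ h₁ n₂ h₂
    have h4 : D ^ 2 * ((b : ℝ) ^ l) ^ 6 ≤ b * x := by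
      calc D ^ 2 * ((b : ℝ) ^ l) ^ 6 = D ^ 2 * ((b : ℝ) ^ l) ^ 3 * ((b : ℝ) ^ l) ^ 3 := by ring
        _ ≤ (d n₁ : ℝ) ^ 2 * ((b : ℝ) ^ l) ^ 3 * ((b : ℝ) ^ l) ^ 3 := by
          gcongr
          exact (hd n₁ h₁).1
        _ ≤ |(n₁ : ℝ) - n₂| * ((b : ℝ) ^ l) ^ 3 := by gcongr
        _ ≤ b * x := h3
    have hbx : 0 < b * x := by positivity
    have : b * x * 1 ≤ b * x * R := by gcongr
    nlinarith
  rw [← Finset.card_image_of_injOn hinj]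
  refine card_dyadic_le (L := b ^ l) (l := l) (n₀ := n₀) (x := x) (by omega) rfl hl hR hRL
    (hA n₀ hn₀).2.1 (hA n₀ hn₀).1 hD (by exact_mod_cast hTL) (by exact_mod_cast h1) h2 _ ?_
  intro e he
  obtain ⟨n, hn, rfl⟩ := Finset.mem_image.mp he
  obtain ⟨a1, a2, m, hm⟩ := hd n hn
  refine ⟨a1, a2, Nat.Coprime.coprime_dvd_left
    ((dvd_pow_self _ two_ne_zero).trans ⟨m, hm⟩) (hA n hn).2.1, m, ?_, ?_⟩
  · have := (hA' n hn n₀ hn₀).1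
    rw [pow_mul] at this
    have hm' : (n : ℤ) = (d n : ℤ) ^ 2 * m := by exact_mod_cast hm
    rw [← hm']
    exact_mod_cast this
  · have := hdiff n hn n₀ hn₀
    have hm' : (n : ℝ) = (d n : ℝ) ^ 2 * m := by exact_mod_cast hm
    rw [hm'] at this
    exact_mod_cast this

/-- Bound for a cluster through the number of possible cofactors of the square divisor. -/
theorem card_cluster_le_of_cofactor {b k : ℕ} {x D : ℝ} (hb : 2 ≤ b) (hx : 0 ≤ x) (hD : 0 < D)
    (hk : 2 * b * D < ((b : ℝ) ^ k) ^ 2)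
    (A : Finset ℕ) (hA : ∀ n ∈ A, 0 < n ∧ (n : ℝ) ≤ x ∧ Nat.Coprime n b ∧
      ∃ d : ℕ, D ≤ (d : ℝ) ∧ (d : ℝ) ≤ 2 * D ∧ d ^ 2 ∣ n)
    (hA' : ∀ n₁ ∈ A, ∀ n₂ ∈ A, (b : ℤ) ^ k ∣ (n₁ : ℤ) - n₂ ∧
      |(n₁ : ℤ) - n₂| * (b : ℤ) ^ k ≤ b * n₁) :
    (A.card : ℝ) ≤ 32 * b * (x / D ^ 2) := by
  classical
  choose! d hd using fun n hn => (hA n hn).2.2.2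
  choose! m hm using fun n hn => (hd n hn).2.2
  have hb0 : (0 : ℝ) < b := by exact_mod_cast (by omega : 0 < b)
  have hmaps : ∀ n ∈ A, m n ∈ Finset.Ioc 0 ⌊x / D ^ 2⌋₊ := by
    intro n hn
    obtain ⟨hn0, hnx, -, -⟩ := hA n hn
    have hm0 : 0 < m n := by
      refine Nat.pos_of_ne_zero fun h => ?_
      have := hm n hn
      rw [h, mul_zero] at this
      omega
    refine Finset.mem_Ioc.mpr ⟨hm0, Nat.le_floor ?_⟩
    rw [le_div_iff₀ (by positivity)]
    have e : (n : ℝ) = (d n : ℝ) ^ 2 * m n := by exact_mod_cast hm n hn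
    calc (m n : ℝ) * D ^ 2 ≤ m n * (d n : ℝ) ^ 2 := by
          gcongr
          exact (hd n hn).1
      _ ≤ x := by rw [mul_comm, ← e]; exact hnx
  have hfib : ∀ c ∈ Finset.Ioc 0 ⌊x / D ^ 2⌋₊, (A.filter fun n => m n = c).card ≤ 32 * b := by
    intro c hc
    have hc0 : 0 < c := (Finset.mem_Ioc.mp hc).1
    rcases (A.filter fun n => m n = c).eq_empty_or_nonempty with h | hne
    · simp [h]
    have hinj : Set.InjOn d (A.filter fun n => m n = c) := by
      intro n₁ h₁ n₂ h₂ he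
      obtain ⟨h₁, e₁⟩ := Finset.mem_filter.mp h₁
      obtain ⟨h₂, e₂⟩ := Finset.mem_filter.mp h₂
      rw [hm n₁ h₁, hm n₂ h₂, he, e₁, e₂]
    have hcop : ∀ n ∈ A, Nat.Coprime (d n) b ∧ Nat.Coprime (m n) b := fun n hn =>
      ⟨Nat.Coprime.coprime_dvd_left ((dvd_pow_self _ two_ne_zero).trans (hd n hn).2.2)
        (hA n hn).2.2.1, Nat.Coprime.coprime_dvd_left ⟨d n ^ 2, (hm n hn).trans (mul_comm _ _)⟩
        (hA n hn).2.2.1⟩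
    have hpair : ∀ n₁ ∈ A.filter fun n => m n = c, ∀ n₂ ∈ A.filter fun n => m n = c,
        (b : ℤ) ^ k ∣ (d n₁ : ℤ) ^ 2 - (d n₂ : ℤ) ^ 2 ∧ |(d n₁ : ℝ) - d n₂| < (b : ℝ) ^ k := by
      intro n₁ h₁ n₂ h₂
      obtain ⟨h₁, e₁⟩ := Finset.mem_filter.mp h₁
      obtain ⟨h₂, e₂⟩ := Finset.mem_filter.mp h₂
      obtain ⟨hdvd, hle⟩ := hA' n₁ h₁ n₂ h₂
      have i₁ : (n₁ : ℤ) = (d n₁ : ℤ) ^ 2 * c := by exact_mod_cast e₁ ▸ hm n₁ h₁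
      have i₂ : (n₂ : ℤ) = (d n₂ : ℤ) ^ 2 * c := by exact_mod_cast e₂ ▸ hm n₂ h₂
      rw [i₁, i₂, ← sub_mul] at hdvd hle
      constructor
      · refine IsCoprime.dvd_of_dvd_mul_right ?_ hdvd
        have := (e₁ ▸ (hcop n₁ h₁).2 : Nat.Coprime c b)
        exact_mod_cast Nat.isCoprime_iff_coprime.mpr (this.symm.pow_left k)
      · rw [abs_mul, Nat.abs_cast] at hle
        have hcr : (0 : ℝ) < c := by exact_mod_cast hc0
        have hle' : |(d n₁ : ℝ) ^ 2 - (d n₂ : ℝ) ^ 2| * c * (b : ℝ) ^ k ≤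
            b * ((d n₁ : ℝ) ^ 2 * c) := by exact_mod_cast hle
        have d₁ : 0 < (d n₁ : ℝ) := hD.trans_le (hd n₁ h₁).1
        have d₂ : 0 < (d n₂ : ℝ) := hD.trans_le (hd n₂ h₂).1
        have hfac : |(d n₁ : ℝ) ^ 2 - (d n₂ : ℝ) ^ 2| =
            |(d n₁ : ℝ) - d n₂| * (d n₁ + d n₂) := by
          rw [sq_sub_sq, abs_mul, abs_of_pos (add_pos d₁ d₂), mul_comm]
        rw [hfac] at hle'
        have hK : (0 : ℝ) < (b : ℝ) ^ k := by positivity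
        have h5 : (d n₁ * c : ℝ) * (|(d n₁ : ℝ) - d n₂| * (b : ℝ) ^ k) ≤
            (d n₁ * c : ℝ) * (b * d n₁) := by
          calc (d n₁ * c : ℝ) * (|(d n₁ : ℝ) - d n₂| * (b : ℝ) ^ k)
              = |(d n₁ : ℝ) - d n₂| * (d n₁) * c * (b : ℝ) ^ k := by ring
            _ ≤ |(d n₁ : ℝ) - d n₂| * (d n₁ + d n₂) * c * (b : ℝ) ^ k := by
              gcongr
              linarith
            _ ≤ b * ((d n₁ : ℝ) ^ 2 * c) := hle'
            _ = _ := by ring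
        have h6 := le_of_mul_le_mul_left h5 (by positivity)
        have h7 : (b : ℝ) * d n₁ ≤ b * (2 * D) := by
          gcongr
          exact (hd n₁ h₁).2.1
        refine lt_of_mul_lt_mul_right ?_ hK.le
        calc |(d n₁ : ℝ) - d n₂| * (b : ℝ) ^ k ≤ 2 * b * D := by linarith
          _ < (b : ℝ) ^ k * (b : ℝ) ^ k := by rwa [← sq]
    rw [← Finset.card_image_of_injOn hinj]
    obtain ⟨n', hn', hmin⟩ := Finset.exists_min_image _ d hne
    have := card_le_of_pow_four_congr (b := b) (q := b ^ k) (g := 1) (l := k) (y := d n')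
      (by omega) dvd_rfl (Nat.pow_pos (by omega))
      ((A.filter fun n => m n = c).image d) ?_ ?_
    · simpa using this
    · intro z hz
      obtain ⟨n, hn, rfl⟩ := Finset.mem_image.mp hz
      refine ⟨hmin n hn, ?_, (hcop n (Finset.mem_filter.mp hn).1).1⟩
      have h8 := (le_abs_self _).trans_lt (hpair n hn n' hn').2
      have : (d n : ℝ) < d n' + 1 * (b : ℝ) ^ k := by linarith
      exact_mod_cast this
    · intro z hz z' hz'
      obtain ⟨n, hn, rfl⟩ := Finset.mem_image.mp hz
      obtain ⟨n'', hn'', rfl⟩ := Finset.mem_image.mp hz'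
      have h9 : (d n'' : ℤ) ^ 4 - (d n : ℤ) ^ 4 =
          ((d n'' : ℤ) ^ 2 - (d n : ℤ) ^ 2) * ((d n'' : ℤ) ^ 2 + (d n : ℤ) ^ 2) := by ring
      rw [h9, Nat.cast_pow]
      exact (hpair n'' hn'' n hn).1.mul_right _
  have hcard := Finset.card_le_mul_card_image_of_maps_to hmaps (32 * b) hfib
  rw [Nat.card_Ioc, Nat.sub_zero] at hcard
  calc (A.card : ℝ) ≤ 32 * b * (⌊x / D ^ 2⌋₊ : ℝ) := by exact_mod_cast hcard
    _ ≤ 32 * b * (x / D ^ 2) := by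
      gcongr
      exact Nat.floor_le (by positivity)

/-- The set counted by `Scount` as a finite set. -/
theorem exists_finset_card_eq_Scount (b : ℕ) (x D : ℝ) :
    ∃ S : Finset ℕ, S.card = Scount b x D ∧ ∀ n ∈ S, 0 < n ∧ (n : ℝ) ≤ x ∧ IsBPalindrome b n ∧
      Nat.Coprime n b ∧ ∃ d : ℕ, D ≤ (d : ℝ) ∧ (d : ℝ) ≤ 2 * D ∧ d ^ 2 ∣ n := by
  have hfin : {n : ℕ | n ∈ PstarSet b x ∧
      ∃ d : ℕ, D ≤ (d : ℝ) ∧ (d : ℝ) ≤ 2 * D ∧ d ^ 2 ∣ n}.Finite :=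
    (Set.finite_Iic ⌊x⌋₊).subset fun n hn => Nat.le_floor hn.1.2.1
  refine ⟨hfin.toFinset, (Set.ncard_eq_toFinset_card _ hfin).symm, fun n hn => ?_⟩
  obtain ⟨⟨h0, hx, hp, hg⟩, hd⟩ := hfin.mem_toFinset.mp hn
  exact ⟨h0, hx, hp, Nat.Coprime.coprime_dvd_right
    (Nat.dvd_sub (dvd_pow_self b three_ne_zero) dvd_rfl) hg, hd⟩

/-- The number of digits is bounded by a small power of the argument. -/
theorem log_floor_pow_add_one_le {b : ℕ} {v : ℝ} (hb : 2 ≤ b) (hv : 1 ≤ v) (N : ℕ) :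
    (Nat.log b ⌊v ^ N⌋₊ + 1 : ℝ) ≤ (2 * N + 1) * v := by
  have hv0 : 0 < v := by linarith
  have h1 : 1 ≤ ⌊v ^ N⌋₊ := Nat.le_floor (by simpa using one_le_pow₀ hv)
  have h2 : (2 : ℝ) ^ Nat.log b ⌊v ^ N⌋₊ ≤ v ^ N := by
    calc (2 : ℝ) ^ Nat.log b ⌊v ^ N⌋₊ ≤ (b : ℝ) ^ Nat.log b ⌊v ^ N⌋₊ := by
          gcongr
          exact_mod_cast hb
      _ ≤ ⌊v ^ N⌋₊ := by exact_mod_cast Nat.pow_log_le_self b (by omega)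
      _ ≤ v ^ N := Nat.floor_le (by positivity)
  have h3 := Real.log_le_log (by positivity) h2
  rw [Real.log_pow, Real.log_pow] at h3
  have h4 := Real.log_le_sub_one_of_pos hv0
  have h5 := Real.log_two_gt_d9
  have h6 : (N : ℝ) * Real.log v ≤ N * v := by
    gcongr
    linarith
  have h7 : (Nat.log b ⌊v ^ N⌋₊ : ℝ) * (1 / 2) ≤ Nat.log b ⌊v ^ N⌋₊ * Real.log 2 := by
    gcongr
    linarith
  linarith

/-- The bound for `D` up to `x ^ (2 / 5)`, where `x = v ^ 2000`. -/
theorem Scount_le_of_le {b : ℕ} {v D : ℝ} (hb : 2 ≤ b) (hv : 1 ≤ v) (hbv : 84 * (b : ℝ) ^ 3 ≤ v ^ 2)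
    (hD₁ : v ^ 460 ≤ D) (hD₂ : D ≤ v ^ 800) :
    (Scount b (v ^ 2000) D : ℝ) ≤ 1728432 * (b : ℝ) ^ 4 * v ^ 999 := by
  have hv0 : 0 < v := by linarith
  have hD : 0 < D := lt_of_lt_of_le (by positivity) hD₁
  have hb1 : (1 : ℝ) ≤ b := by exact_mod_cast (by omega : 1 ≤ b)
  have hb3 : (b : ℝ) ≤ (b : ℝ) ^ 3 := le_self_pow₀ hb1 three_ne_zero
  have hy : v ^ 204 ≤ v ^ 1004 / D := by
    rw [le_div_iff₀ hD]
    calc v ^ 204 * D ≤ v ^ 204 * v ^ 800 := by gcongr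
      _ = v ^ 1004 := by rw [← pow_add]
  obtain ⟨l, hl₁, hl₂⟩ := exists_nat_pow_near (x := v ^ 1004 / D) (y := (b : ℝ) ^ 3)
    ((one_le_pow₀ hv).trans hy) (one_lt_pow₀ (by exact_mod_cast hb) three_ne_zero)
  set L : ℝ := (b : ℝ) ^ (l + 1) with hL
  have hL0 : 0 < L := by positivity
  have hq : L ^ 3 = ((b : ℝ) ^ 3) ^ (l + 1) := by rw [hL, ← pow_mul, ← pow_mul, mul_comm]
  have hq₂ : v ^ 1004 ≤ L ^ 3 * D := by
    rw [← hq, div_lt_iff₀ hD] at hl₂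
    exact hl₂.le
  have hq₁ : L ^ 3 * D ≤ (b : ℝ) ^ 3 * v ^ 1004 := by
    rw [le_div_iff₀ hD] at hl₁
    rw [hq, pow_succ]
    calc ((b : ℝ) ^ 3) ^ l * (b : ℝ) ^ 3 * D = (b : ℝ) ^ 3 * (((b : ℝ) ^ 3) ^ l * D) := by ring
      _ ≤ _ := by gcongr
  have hv6 : 1 ≤ v ^ 6 := one_le_pow₀ hv
  set R : ℕ := ⌊v ^ 6⌋₊ with hR
  have hR1 : 1 ≤ R := Nat.le_floor (by simpa using hv6)
  have hR1' : (1 : ℝ) ≤ R := by exact_mod_cast hR1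
  have hRv : (R : ℝ) ≤ v ^ 6 := Nat.floor_le (by positivity)
  have hvR : v ^ 6 ≤ 2 * (R : ℝ) := by
    have := Nat.lt_floor_add_one (v ^ 6)
    rw [← hR] at this
    linarith
  have hRL : R ^ 7 ≤ b ^ (l + 1) := by
    have : ((R : ℝ) ^ 7) ^ 3 ≤ L ^ 3 := by
      calc ((R : ℝ) ^ 7) ^ 3 ≤ ((v ^ 6) ^ 7) ^ 3 := by gcongr
        _ = v ^ 126 := by rw [← pow_mul, ← pow_mul]
        _ ≤ v ^ 204 := pow_le_pow_right₀ hv (by norm_num)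
        _ ≤ v ^ 1004 / D := hy
        _ ≤ L ^ 3 := by rw [hq]; exact hl₂.le
    have := le_of_pow_le_pow_left₀ three_ne_zero hL0.le this
    rw [hL] at this
    exact_mod_cast this
  have hTL : (R : ℝ) ^ 4 * L ≤ D := by
    refine le_of_pow_le_pow_left₀ three_ne_zero hD.le ?_
    refine le_of_mul_le_mul_right ?_ hD
    calc ((R : ℝ) ^ 4 * L) ^ 3 * D = (R : ℝ) ^ 12 * (L ^ 3 * D) := by ring
      _ ≤ (v ^ 6) ^ 12 * ((b : ℝ) ^ 3 * v ^ 1004) := by gcongr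
      _ ≤ (v ^ 6) ^ 12 * (v ^ 2 * v ^ 1004) := by
        gcongr
        linarith [pow_pos (lt_of_lt_of_le one_pos hb1) 3]
      _ = v ^ 1078 := by rw [← pow_mul, ← pow_add, ← pow_add]
      _ ≤ v ^ 1840 := pow_le_pow_right₀ hv (by norm_num)
      _ = (v ^ 460) ^ 4 := by rw [← pow_mul]
      _ ≤ D ^ 4 := by gcongr
      _ = D ^ 3 * D := pow_succ D 3
  have h1 : 12 * b * v ^ 2000 * R ≤ L ^ 6 * D ^ 2 := by
    calc 12 * b * v ^ 2000 * (R : ℝ) ≤ v ^ 2 * v ^ 2000 * v ^ 6 := by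
          gcongr
          linarith
      _ = (v ^ 1004) ^ 2 := by rw [← pow_mul, ← pow_add, ← pow_add]
      _ ≤ (L ^ 3 * D) ^ 2 := by gcongr
      _ = L ^ 6 * D ^ 2 := by ring
  have h2 : 84 * v ^ 2000 * (R : ℝ) ^ 13 ≤ D ^ 5 := by
    calc 84 * v ^ 2000 * (R : ℝ) ^ 13 ≤ v ^ 2 * v ^ 2000 * (v ^ 6) ^ 13 := by
          gcongr
          linarith
      _ = v ^ 2080 := by rw [← pow_mul, ← pow_add, ← pow_add]
      _ ≤ v ^ 2300 := pow_le_pow_right₀ hv (by norm_num)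
      _ = (v ^ 460) ^ 5 := by rw [← pow_mul]
      _ ≤ D ^ 5 := by gcongr
  obtain ⟨S, hS, hmem⟩ := exists_finset_card_eq_Scount b (v ^ 2000) D
  have hcard := card_le_of_forall_cluster (k := (l + 1) * 3) (M := ⌊v ^ 2000⌋₊)
    (B := 216 * b * D / R) hb S (fun n hn => ⟨(hmem n hn).2.2.1, Nat.le_floor (hmem n hn).2.1⟩)
    (fun A hA hA' => card_cluster_le_of_dyadic hb l.succ_pos hR1 hRL (one_le_pow₀ hv) hD hTL h1 h2
      A (fun n hn => ⟨(hmem n (hA hn)).2.1, (hmem n (hA hn)).2.2.2⟩) hA')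
  rw [hS, pow_mul, ← hL] at hcard
  have hlog := log_floor_pow_add_one_le hb hv 2000
  have hB : L ^ 3 * (216 * b * D / R) ≤ 432 * (b : ℝ) ^ 4 * v ^ 998 := by
    rw [← mul_div_assoc, div_le_iff₀ (by positivity)]
    calc L ^ 3 * (216 * b * D) = 216 * b * (L ^ 3 * D) := by ring
      _ ≤ 216 * b * ((b : ℝ) ^ 3 * v ^ 1004) := by gcongr
      _ = 216 * (b : ℝ) ^ 4 * (v ^ 998 * v ^ 6) := by rw [← pow_add]; ring
      _ ≤ 216 * (b : ℝ) ^ 4 * (v ^ 998 * (2 * (R : ℝ))) := by gcongr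
      _ = _ := by ring
  calc (Scount b (v ^ 2000) D : ℝ)
      ≤ (Nat.log b ⌊v ^ 2000⌋₊ + 1) * (L ^ 3 * (216 * b * D / R)) := by rwa [← mul_assoc]
    _ ≤ ((2 * (2000 : ℕ) + 1) * v) * (432 * (b : ℝ) ^ 4 * v ^ 998) := by gcongr
    _ = 1728432 * (b : ℝ) ^ 4 * (v ^ 998 * v) := by push_cast; ring
    _ = _ := by rw [← pow_succ]

/-- The bound for `D` from `x ^ (2 / 5)` to `x ^ (1 / 2)`, where `x = v ^ 2000`. -/
theorem Scount_le_of_ge {b : ℕ} {v D : ℝ} (hb : 2 ≤ b) (hv : 1 ≤ v)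
    (hD₁ : v ^ 800 ≤ D) (hD₂ : D ≤ v ^ 1000) :
    (Scount b (v ^ 2000) D : ℝ) ≤ 256064 * (b : ℝ) ^ 3 * v ^ 999 := by
  have hv0 : 0 < v := by linarith
  have hD1 : 1 ≤ D := (one_le_pow₀ hv).trans hD₁
  have hD : 0 < D := by linarith
  have hb1 : (1 : ℝ) ≤ b := by exact_mod_cast (by omega : 1 ≤ b)
  obtain ⟨k, hk₁, hk₂⟩ := exists_nat_pow_near (x := 2 * b * D) (y := (b : ℝ) ^ 2)
    (by nlinarith) (one_lt_pow₀ (by exact_mod_cast hb) two_ne_zero)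
  set K : ℝ := (b : ℝ) ^ (k + 1) with hK
  have hK0 : 0 < K := by positivity
  have hq : K ^ 2 = ((b : ℝ) ^ 2) ^ (k + 1) := by rw [hK, ← pow_mul, ← pow_mul, mul_comm]
  have hKv : K ≤ 2 * (b : ℝ) ^ 2 * v ^ 500 := by
    refine le_of_pow_le_pow_left₀ two_ne_zero (by positivity) ?_
    calc K ^ 2 = (b : ℝ) ^ 2 * ((b : ℝ) ^ 2) ^ k := by rw [hq, pow_succ']
      _ ≤ (b : ℝ) ^ 2 * (2 * b * D) := by gcongr
      _ = 2 * (b : ℝ) ^ 3 * D := by ring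
      _ ≤ 4 * (b : ℝ) ^ 4 * v ^ 1000 := by
        gcongr
        · norm_num
        · norm_num
      _ = 4 * (b : ℝ) ^ 4 * (v ^ 500) ^ 2 := by rw [← pow_mul]
      _ = _ := by ring
  obtain ⟨S, hS, hmem⟩ := exists_finset_card_eq_Scount b (v ^ 2000) D
  have hcard := card_le_of_forall_cluster (k := k + 1) (M := ⌊v ^ 2000⌋₊)
    (B := 32 * b * (v ^ 2000 / D ^ 2)) hb S
    (fun n hn => ⟨(hmem n hn).2.2.1, Nat.le_floor (hmem n hn).2.1⟩)
    (fun A hA hA' => card_cluster_le_of_cofactor hb (by positivity) hD (by rwa [← hK, hq])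
      A (fun n hn => ⟨(hmem n (hA hn)).1, (hmem n (hA hn)).2.1, (hmem n (hA hn)).2.2.2⟩) hA')
  rw [hS, ← hK] at hcard
  have hlog := log_floor_pow_add_one_le hb hv 2000
  have hx : v ^ 2000 / D ^ 2 ≤ v ^ 400 := by
    rw [div_le_iff₀ (by positivity)]
    calc v ^ 2000 = v ^ 400 * (v ^ 800) ^ 2 := by rw [← pow_mul, ← pow_add]
      _ ≤ v ^ 400 * D ^ 2 := by gcongr
  calc (Scount b (v ^ 2000) D : ℝ)
      ≤ (Nat.log b ⌊v ^ 2000⌋₊ + 1) * K * (32 * b * (v ^ 2000 / D ^ 2)) := hcard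
    _ ≤ ((2 * (2000 : ℕ) + 1) * v) * (2 * (b : ℝ) ^ 2 * v ^ 500) * (32 * b * v ^ 400) := by
      gcongr
    _ = 256064 * (b : ℝ) ^ 3 * (v * v ^ 500 * v ^ 400) := by push_cast; ring
    _ = 256064 * (b : ℝ) ^ 3 * v ^ 901 := by rw [← pow_succ', ← pow_add]
    _ ≤ 256064 * (b : ℝ) ^ 3 * v ^ 999 := by
      gcongr 256064 * (b : ℝ) ^ 3 * ?_
      exact pow_le_pow_right₀ hv (by norm_num)

/-- There is nothing to count once `D ^ 2` exceeds `x`. -/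
theorem Scount_eq_zero_of_lt {b : ℕ} {x D : ℝ} (hD : 0 ≤ D) (hx : x < D ^ 2) :
    Scount b x D = 0 := by
  obtain ⟨S, hS, hmem⟩ := exists_finset_card_eq_Scount b x D
  rw [← hS, Finset.card_eq_zero]
  refine Finset.eq_empty_of_forall_notMem fun n hn => ?_
  obtain ⟨h0, hnx, -, -, d, hd, -, hdn⟩ := hmem n hn
  have h1 : (d : ℝ) ^ 2 ≤ n := by exact_mod_cast Nat.le_of_dvd h0 hdn
  have h2 : D ^ 2 ≤ (d : ℝ) ^ 2 := by gcongr
  linarith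

/-- The trivial bound. -/
theorem Scount_le_self {x : ℝ} (hx : 0 ≤ x) (b : ℕ) (D : ℝ) :
    (Scount b x D : ℝ) ≤ x := by
  obtain ⟨S, hS, hmem⟩ := exists_finset_card_eq_Scount b x D
  have hsub : S ⊆ Finset.Ioc 0 ⌊x⌋₊ := fun n hn =>
    Finset.mem_Ioc.mpr ⟨(hmem n hn).1, Nat.le_floor (hmem n hn).2.1⟩
  have := Finset.card_le_card hsub
  rw [hS, Nat.card_Ioc, Nat.sub_zero] at this
  exact (Nat.cast_le.mpr this).trans (Nat.floor_le hx)

/-- The power saving in terms of `v = x ^ (1 / 2000)`. -/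
theorem exists_Scount_le {b : ℕ} (hb : 2 ≤ b) : ∃ C : ℝ, ∀ v D : ℝ, 1 ≤ v → v ^ 460 ≤ D →
    (Scount b (v ^ 2000) D : ℝ) ≤ C * v ^ 999 := by
  obtain ⟨C₀, hC₀⟩ : ∃ C₀ : ℝ, C₀ = (84 * (b : ℝ) ^ 3) ^ 1000 := ⟨_, rfl⟩
  have hC₀' : 0 ≤ C₀ := by rw [hC₀]; positivity
  refine ⟨C₀ + 1728432 * (b : ℝ) ^ 4 + 256064 * (b : ℝ) ^ 3, fun v D hv hD => ?_⟩
  have hv0 : 0 < v := by linarith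
  rw [add_mul, add_mul]
  have p1 : 0 ≤ C₀ * v ^ 999 := by positivity
  have p2 : 0 ≤ 1728432 * (b : ℝ) ^ 4 * v ^ 999 := by positivity
  have p3 : 0 ≤ 256064 * (b : ℝ) ^ 3 * v ^ 999 := by positivity
  rcases le_or_gt (v ^ 1000) D with h | h
  · rcases h.eq_or_lt with h | h
    · have := Scount_le_of_ge hb hv (h ▸ pow_le_pow_right₀ hv (by norm_num)) h.ge
      linarith
    · rw [Scount_eq_zero_of_lt (le_trans (by positivity) hD) ?_]
      · rw [Nat.cast_zero]
        positivity
      · calc v ^ 2000 = (v ^ 1000) ^ 2 := by rw [← pow_mul]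
          _ < D ^ 2 := by gcongr
  rcases le_total D (v ^ 800) with h' | h'
  · rcases le_total (84 * (b : ℝ) ^ 3) (v ^ 2) with hbv | hbv
    · have := Scount_le_of_le hb hv hbv hD h'
      linarith
    · have h1 : v ^ 2000 ≤ C₀ := by
        rw [hC₀]
        calc v ^ 2000 = (v ^ 2) ^ 1000 := by rw [← pow_mul]
          _ ≤ _ := by gcongr
      have h2 : C₀ * 1 ≤ C₀ * v ^ 999 := by
        gcongr
        exact one_le_pow₀ hv
      have := Scount_le_self (pow_pos hv0 2000).le b D
      linarith
  · have := Scount_le_of_ge hb hv h' h.le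
    linarith

/-- For all `b ≥ 2` and `ε > 0`, if `D ≥ x^{3/13+ε}` then there exists `δ > 0`
with `S_b(x,D) ≪_{b,ε} x^{1/2-δ}`. -/
theorem Scount_powersaving (b : ℕ) (hb : 2 ≤ b) (ε : ℝ) (hε : 0 < ε) :
    ∃ δ : ℝ, 0 < δ ∧ ∃ C : ℝ, ∀ x D : ℝ, 1 ≤ x → x ^ ((3 : ℝ) / 13 + ε) ≤ D →
      (Scount b x D : ℝ) ≤ C * x ^ ((1 : ℝ) / 2 - δ) := by
  obtain ⟨C, hC⟩ := exists_Scount_le hb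
  refine ⟨1 / 2000, by norm_num, C, fun x D hx hD => ?_⟩
  have hx0 : 0 ≤ x := by linarith
  have hpow : ∀ k : ℕ, (x ^ ((1 : ℝ) / 2000)) ^ k = x ^ ((k : ℝ) / 2000) := by
    intro k
    rw [← Real.rpow_mul_natCast hx0]
    congr 1
    ring
  have h1 : (x ^ ((1 : ℝ) / 2000)) ^ 2000 = x := by
    rw [hpow]
    norm_num
  have h2 := hC (x ^ ((1 : ℝ) / 2000)) D (Real.one_le_rpow hx (by norm_num)) ?_
  · rw [h1, hpow] at h2
    convert h2 using 3
    norm_num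
  · rw [hpow]
    refine le_trans (Real.rpow_le_rpow_of_exponent_le hx ?_) hD
    push_cast
    linarith
end

section
/- For a fixed base b ≥ 2, the number of n ∈ Π*_b(N) that admit a divisor d² with d an integer satisfying D ≤ d ≤ 2D is ≪_b b^N / D^{3/2}; that is, there is a constant C depending only on b such that for all N ≥ 1 and D ≥ 1, #{n ∈ Π*_b(N) : ∃ d ∈ [D,2D], d² ∣ n} ≤ C b^N / D^{3/2}. -/
/-- `Π*_b(N)`: the `N`-digit base-`b` palindromes coprime to `b³ - b`. -/
def PiStarSet (b N : ℕ) : Set ℕ :=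
  {n : ℕ | b ^ (N - 1) ≤ n ∧ n < b ^ N ∧ IsBPalindrome b n ∧ Nat.gcd n (b ^ 3 - b) = 1}

/-- Two palindromes of the same length whose last `k` digits agree have the same first
`k` digits. -/
theorem IsBPalindrome.div_pow_eq_of_mod_pow_eq {b n n' N k : ℕ} (hb : 2 ≤ b)
    (hn : IsBPalindrome b n) (hn' : IsBPalindrome b n') (hl : (b.digits n).length = N)
    (hl' : (b.digits n').length = N) (hk : k ≤ N) (h : n % b ^ k = n' % b ^ k) :
    n / b ^ (N - k) = n' / b ^ (N - k) := by
  have key : (b.digits n).take k = (b.digits n').take k := by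
    rw [Nat.self_mod_pow_eq_ofDigits_take k n hb, Nat.self_mod_pow_eq_ofDigits_take k n' hb] at h
    refine Nat.ofDigits_inj_of_len_eq (by omega) (by simp [hl, hl']) ?_ ?_ h
    · exact fun d hd => Nat.digits_lt_base (by omega) (List.mem_of_mem_take hd)
    · exact fun d hd => Nat.digits_lt_base (by omega) (List.mem_of_mem_take hd)
  rw [Nat.self_div_pow_eq_ofDigits_drop _ n hb, Nat.self_div_pow_eq_ofDigits_drop _ n' hb,
    ← hn.2.reverse_eq, ← hn'.2.reverse_eq, List.drop_reverse, List.drop_reverse, hl, hl',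
    Nat.sub_sub_self hk, key]

/-- The `N`-digit bounds determine the number of digits. -/
theorem PiStarSet.length_digits {b n N : ℕ} (hb : 2 ≤ b) (hN : 1 ≤ N) (hn : n ∈ PiStarSet b N) :
    (b.digits n).length = N := by
  have h1 := (Nat.digits_length_le_iff hb n).2 hn.2.1
  have h2 := (Nat.lt_digits_length_iff hb n).2 hn.1
  omega

/-- For a fixed cofactor `m`, the numbers `m * d ^ 2 ∈ Π*_b(N)` with `d < 2 * b ^ (2 * k + 2)`
have roots `d` that are distinct modulo `b ^ (k + 3)`. -/
theorem PiStarSet.eq_of_mul_sq {b N k m d e : ℕ} (hb : 2 ≤ b) (hN : 1 ≤ N) (hk : k ≤ N)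
    (hd : m * d ^ 2 ∈ PiStarSet b N) (he : m * e ^ 2 ∈ PiStarSet b N)
    (hdb : d < 2 * b ^ (2 * k + 2)) (hde : d ≤ e) (hmod : d ≡ e [MOD b ^ (k + 3)]) :
    d = e := by
  by_contra hne
  have hlt : d < e := lt_of_le_of_ne hde hne
  have hgap : b ^ (k + 3) ≤ e - d :=
    Nat.le_of_dvd (by omega) ((Nat.modEq_iff_dvd' hde).1 hmod)
  obtain ⟨g, rfl⟩ := Nat.exists_eq_add_of_le hde
  replace hgap : b ^ (k + 3) ≤ g := by omega
  have hmod' : m * d ^ 2 ≡ m * (d + g) ^ 2 [MOD b ^ k] :=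
    ((hmod.of_dvd (pow_dvd_pow b (by omega))).pow 2).mul_left m
  have htop := IsBPalindrome.div_pow_eq_of_mod_pow_eq hb hd.2.2.1 he.2.2.1
    (length_digits hb hN hd) (length_digits hb hN he) hk hmod'
  have hB : 0 < b ^ (N - k) := by positivity
  have hclose : m * (d + g) ^ 2 < m * d ^ 2 + b ^ (N - k) := by
    have h1 := Nat.div_add_mod (m * d ^ 2) (b ^ (N - k))
    have h2 := Nat.div_add_mod (m * (d + g) ^ 2) (b ^ (N - k))
    have h3 := Nat.mod_lt (m * (d + g) ^ 2) hB
    rw [htop] at h1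
    linarith [Nat.zero_le (m * d ^ 2 % b ^ (N - k))]
  have hlow : b ^ (N - 1) ≤ m * d ^ 2 := hd.1
  have h1 : m * g * (2 * d) < b ^ (N - k) := by nlinarith [Nat.zero_le (m * g ^ 2)]
  have h2 : 2 * b ^ (N + k + 2) ≤ 2 * (m * d ^ 2) * g := by
    calc 2 * b ^ (N + k + 2) = 2 * b ^ (N - 1) * b ^ (k + 3) := by
          rw [mul_assoc, ← pow_add]; congr 2; omega
      _ ≤ _ := by gcongr
  have h3 : b ^ (N - k) * d ≤ 2 * b ^ (N + k + 2) := by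
    calc b ^ (N - k) * d ≤ b ^ (N - k) * (2 * b ^ (2 * k + 2)) := by gcongr
      _ = 2 * b ^ (N + k + 2) := by
          rw [mul_left_comm, ← pow_add]; congr 2; omega
  have hd0 : 0 < d := by
    rcases Nat.eq_zero_or_pos d with rfl | h
    · have : 0 < b ^ (N - 1) := by positivity
      simp at hlow
      omega
    · exact h
  have h4 : m * g * (2 * d) * d < b ^ (N - k) * d := Nat.mul_lt_mul_of_pos_right h1 hd0
  nlinarith

/-- The number of `n ∈ Π*_b(N)` divisible by `d²` for some `d ∈ [D, 2D]` is
`≪_b b^N / D^{3/2}`. -/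
theorem PiStar_square_divisor_count (b : ℕ) (hb : 2 ≤ b) :
    ∃ C : ℝ, ∀ N : ℕ, 1 ≤ N → ∀ D : ℝ, 1 ≤ D →
      (({n : ℕ | n ∈ PiStarSet b N ∧
          ∃ d : ℕ, D ≤ (d : ℝ) ∧ (d : ℝ) ≤ 2 * D ∧ d ^ 2 ∣ n}.ncard : ℝ)) ≤
        C * (b : ℝ) ^ N / D ^ ((3 : ℝ) / 2) := by
  refine ⟨(b : ℝ) ^ 3, fun N hN D hD => ?_⟩
  have hD0 : 0 < D := by linarith
  obtain ⟨k, hk1, hk2⟩ := exists_nat_pow_near hD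
    (show (1 : ℝ) < (b : ℝ) ^ 2 by
      have : (2 : ℝ) ≤ b := by exact_mod_cast hb
      nlinarith)
  rw [← pow_mul] at hk1 hk2
  set S := {n : ℕ | n ∈ PiStarSet b N ∧
    ∃ d : ℕ, D ≤ (d : ℝ) ∧ (d : ℝ) ≤ 2 * D ∧ d ^ 2 ∣ n}
  have hex : ∀ n ∈ S, ∃ p : ℕ × ℕ, n = p.1 * p.2 ^ 2 ∧ D ≤ (p.2 : ℝ) ∧ (p.2 : ℝ) ≤ 2 * D := by
    rintro n ⟨-, d, h1, h2, m, rfl⟩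
    exact ⟨(m, d), mul_comm _ _, h1, h2⟩
  choose! f hf hf1 hf2 using hex
  set M := ⌊(b : ℝ) ^ N / D ^ 2⌋₊
  have hpos : ∀ n ∈ S, 0 < n := fun n hn => lt_of_lt_of_le (by positivity) hn.1.1
  have hupper : ∀ n ∈ S, ((f n).2 : ℝ) < 2 * (b : ℝ) ^ (2 * k + 2) := fun n hn =>
    (hf2 n hn).trans_lt (by rw [show 2 * k + 2 = 2 * (k + 1) by ring]; linarith)
  have hkN : ∀ n ∈ S, k ≤ N := by
    intro n hn
    have h1 : b ^ (2 * k) ≤ (f n).2 := by exact_mod_cast hk1.trans (hf1 n hn)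
    have h2 : (f n).2 ≤ n := by
      have h := hf n hn
      have h0 : 0 < (f n).1 := Nat.pos_of_ne_zero fun h0 => by
        have := hpos n hn
        rw [h0, zero_mul] at h
        omega
      calc (f n).2 ≤ (f n).2 ^ 2 := Nat.le_self_pow two_ne_zero _
        _ ≤ (f n).1 * (f n).2 ^ 2 := Nat.le_mul_of_pos_left _ h0
        _ = n := h.symm
    have h3 := (Nat.pow_lt_pow_iff_right (show 1 < b by omega)).1
      ((h1.trans h2).trans_lt hn.1.2.1)
    omega
  have hcard : S.ncard ≤ M * b ^ (k + 3) := by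
    have hT : ((Finset.Icc 1 M ×ˢ Finset.range (b ^ (k + 3)) : Finset (ℕ × ℕ)) :
        Set (ℕ × ℕ)).ncard = M * b ^ (k + 3) := by
      rw [Set.ncard_coe_finset]
      simp
    rw [← hT]
    refine Set.ncard_le_ncard_of_injOn (fun n => ((f n).1, (f n).2 % b ^ (k + 3))) ?_ ?_
      (Finset.finite_toSet _)
    · intro n hn
      have h := hf n hn
      have h0 := hpos n hn
      simp only [Finset.coe_product, Set.mem_prod, Finset.mem_coe, Finset.mem_Icc,
        Finset.mem_range]
      refine ⟨⟨Nat.pos_of_ne_zero fun h1 => ?_, Nat.le_floor ?_⟩, Nat.mod_lt _ (by positivity)⟩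
      · rw [h1, zero_mul] at h
        omega
      · rw [le_div_iff₀ (by positivity)]
        calc ((f n).1 : ℝ) * D ^ 2 ≤ (f n).1 * ((f n).2 : ℝ) ^ 2 := by
              gcongr
              exact hf1 n hn
          _ = (n : ℝ) := by exact_mod_cast h.symm
          _ ≤ (b : ℝ) ^ N := by exact_mod_cast hn.1.2.1.le
    · intro n hn n' hn' hnn
      obtain ⟨h1, h2⟩ := Prod.mk.inj hnn
      have hm := hn.1
      have hm' := hn'.1
      rw [hf n hn] at hm
      rw [hf n' hn', ← h1] at hm'
      have hu : (f n).2 < 2 * b ^ (2 * k + 2) := by exact_mod_cast hupper n hn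
      have hu' : (f n').2 < 2 * b ^ (2 * k + 2) := by exact_mod_cast hupper n' hn'
      have heq : (f n).2 = (f n').2 := by
        rcases le_total (f n).2 (f n').2 with h | h
        · exact PiStarSet.eq_of_mul_sq hb hN (hkN n hn) hm hm' hu h h2
        · exact (PiStarSet.eq_of_mul_sq hb hN (hkN n hn) hm' hm hu' h h2.symm).symm
      rw [hf n hn, hf n' hn', h1, heq]
  have hbk : (b : ℝ) ^ k ≤ D ^ ((1 : ℝ) / 2) := by
    rw [← Real.sqrt_eq_rpow]
    exact Real.le_sqrt_of_sq_le (by rw [← pow_mul, mul_comm]; exact hk1)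
  have hsplit : D ^ ((3 : ℝ) / 2) * D ^ ((1 : ℝ) / 2) = D ^ 2 := by
    rw [← Real.rpow_add hD0, ← Real.rpow_natCast]
    norm_num
  calc (S.ncard : ℝ) ≤ M * (b : ℝ) ^ (k + 3) := by exact_mod_cast hcard
    _ ≤ (b : ℝ) ^ N / D ^ 2 * (D ^ ((1 : ℝ) / 2) * (b : ℝ) ^ 3) := by
        rw [pow_add]
        gcongr
        exact Nat.floor_le (by positivity)
    _ = (b : ℝ) ^ 3 * (b : ℝ) ^ N / D ^ ((3 : ℝ) / 2) := by
        rw [← hsplit]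
        have h1 : D ^ ((1 : ℝ) / 2) ≠ 0 := by positivity
        have h2 : D ^ ((3 : ℝ) / 2) ≠ 0 := by positivity
        field_simp
end

section
/- Let [a,b] ⊂ ℝ and let F : [a,b] → ℝ be twice differentiable with either F″(x) > r > 0 for all x ∈ [a,b] or F″(x) < −r < 0 for all x ∈ [a,b]. Let G : [a,b] → ℝ satisfy 0 ≤ G(x) ≤ M (M > 0) and suppose G is piecewise monotonic with K monotonic pieces (i.e. [a,b] can be partitioned into K subintervals on each of which G is monotonic). Then |∫_a^b G(x) e^{iF(x)} dx| ≤ 8KM/√r. -/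
open MeasureTheory Set in
/-- A bound on the integrals of `h` over subintervals bounds its integral over any order-connected
subset of the interval. -/
theorem norm_setIntegral_le_of_ordConnected {h : ℝ → ℂ} {p q C : ℝ} (hC0 : 0 ≤ C)
    (hC : ∀ c d, p ≤ c → c ≤ d → d ≤ q → ‖∫ x in c..d, h x‖ ≤ C)
    {S : Set ℝ} (hS : S.OrdConnected) (hSpq : S ⊆ Icc p q) :
    ‖∫ x in S, h x‖ ≤ C := by
  rcases S.eq_empty_or_nonempty with rfl | hne
  · simpa using hC0
  have hconn : IsConnected S := ⟨hne, hS.isPreconnected⟩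
  have hb : BddBelow S := bddBelow_Icc.mono hSpq
  have ha : BddAbove S := bddAbove_Icc.mono hSpq
  have hle : sInf S ≤ sSup S := Real.sInf_le_sSup S hb ha
  have hae : S =ᵐ[volume] Ioc (sInf S) (sSup S) := by
    refine Filter.EventuallyLE.antisymm ?_ ?_
    · exact (subset_Icc_csInf_csSup hb ha).eventuallyLE.trans Ioc_ae_eq_Icc.symm.le
    · exact Ioo_ae_eq_Ioc.symm.le.trans (hconn.Ioo_csInf_csSup_subset hb ha).eventuallyLE
  rw [setIntegral_congr_set hae, ← intervalIntegral.integral_of_le hle]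
  exact hC _ _ (le_csInf hne fun x hx => (hSpq hx).1) hle (csSup_le hne fun x hx => (hSpq hx).2)

open MeasureTheory Set in
/-- A bound on the integrals of `h` over subintervals yields a bound on the integral of `h`
weighted by a nonnegative bounded function whose superlevel sets are intervals. -/
theorem norm_integral_weight_mul_le {h : ℝ → ℂ} (hh : Continuous h) {G : ℝ → ℝ}
    (hG : Measurable G) {p q M C : ℝ} (hpq : p ≤ q) (hM : 0 ≤ M) (hC0 : 0 ≤ C)
    (hG0 : ∀ x, 0 ≤ G x) (hGM : ∀ x, G x ≤ M)
    (hlev : ∀ s, {x | s < G x}.OrdConnected)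
    (hC : ∀ c d, p ≤ c → c ≤ d → d ≤ q → ‖∫ x in c..d, h x‖ ≤ C) :
    ‖∫ x in p..q, (G x : ℂ) * h x‖ ≤ M * C := by
  set A : Set (ℝ × ℝ) := {z | z.2 < G z.1} with hA
  have hAm : MeasurableSet A := measurableSet_lt measurable_snd (hG.comp measurable_fst)
  set f : ℝ → ℝ → ℂ := fun x s => A.indicator (fun z => h z.1) (x, s) with hf
  have hint : Integrable (Function.uncurry f)
      ((volume.restrict (Ioc p q)).prod (volume.restrict (Ioc 0 M))) := by
    have h1 : Integrable h (volume.restrict (Ioc p q)) :=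
      (hh.integrableOn_Icc).mono_set Ioc_subset_Icc_self
    exact (h1.comp_fst _).indicator hAm
  have hinner : ∀ x, ∫ s in Ioc 0 M, f x s = (G x : ℂ) * h x := by
    intro x
    have : ∀ s, f x s = (Iio (G x)).indicator (fun _ => h x) s := by
      intro s
      simp [hf, hA, indicator]
    simp_rw [this]
    rw [setIntegral_indicator measurableSet_Iio, setIntegral_const]
    have : volume.real (Ioc 0 M ∩ Iio (G x)) = G x := by
      have h2 : (Ioc 0 M ∩ Iio (G x) : Set ℝ) = Ioo 0 (G x) := by
        ext s
        simp only [mem_inter_iff, mem_Ioc, mem_Iio, mem_Ioo]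
        exact ⟨fun h => ⟨h.1.1, h.2⟩, fun h => ⟨⟨h.1, h.2.le.trans (hGM x)⟩, h.2⟩⟩
      rw [h2, Real.volume_real_Ioo_of_le (hG0 x), sub_zero]
    rw [this, Complex.real_smul]
  have houter : ∀ s, ‖∫ x in Ioc p q, f x s‖ ≤ C := by
    intro s
    have h3 : ∀ x, f x s = {x | s < G x}.indicator h x := by
      intro x
      simp [hf, hA, indicator]
    simp_rw [h3]
    rw [setIntegral_indicator (measurableSet_lt measurable_const hG)]
    exact norm_setIntegral_le_of_ordConnected hC0 hC (ordConnected_Ioc.inter (hlev s))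
      (inter_subset_left.trans Ioc_subset_Icc_self)
  rw [intervalIntegral.integral_of_le hpq]
  simp_rw [← hinner]
  rw [integral_integral_swap hint]
  refine (norm_setIntegral_le_of_norm_le_const (C := C) (by simp) fun s _ => houter s).trans ?_
  rw [Real.volume_real_Ioc_of_le hM, sub_zero, mul_comm]

open Set in
/-- First-derivative test for the oscillatory integral of `exp (i F)`, increasing phase
derivative. -/
theorem norm_integral_exp_le_of_le_deriv {F F' F'' : ℝ → ℝ} {c d m : ℝ} (hcd : c ≤ d) (hm : 0 < m)
    (hF : ∀ x ∈ Icc c d, HasDerivAt F (F' x) x)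
    (hF' : ∀ x ∈ Icc c d, HasDerivAt F' (F'' x) x)
    (hF'' : ∀ x ∈ Icc c d, 0 ≤ F'' x) (hmc : m ≤ F' c) :
    ‖∫ x in c..d, Complex.exp (Complex.I * (F x : ℂ))‖ ≤ 2 / m := by
  have hFc : ContinuousOn F (Icc c d) := fun x hx => (hF x hx).continuousAt.continuousWithinAt
  have hF'c : ContinuousOn F' (Icc c d) := fun x hx => (hF' x hx).continuousAt.continuousWithinAt
  have hmono : MonotoneOn F' (Icc c d) := by
    refine monotoneOn_of_deriv_nonneg (convex_Icc c d) hF'c ?_ ?_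
    · intro x hx
      exact (hF' x (interior_subset hx)).differentiableAt.differentiableWithinAt
    · intro x hx
      rw [(hF' x (interior_subset hx)).deriv]
      exact hF'' x (interior_subset hx)
  have hpos : ∀ x ∈ Icc c d, 0 < F' x := fun x hx =>
    (hm.trans_le hmc).trans_le (hmono (left_mem_Icc.2 hcd) hx hx.1)
  set E : ℝ → ℂ := fun x => Complex.exp (Complex.I * (IccExtend hcd (domRestrict (Icc c d) F) x : ℝ))
    with hE
  have hEc : Continuous E := by
    have : Continuous (IccExtend hcd (domRestrict (Icc c d) F)) :=
      (continuousOn_iff_continuous_domRestrict.1 hFc).Icc_extend'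
    fun_prop
  have hEF : ∀ x ∈ Icc c d, E x = Complex.exp (Complex.I * (F x : ℂ)) := by
    intro x hx
    simp [hE, IccExtend_of_mem hcd _ hx, domRestrict_apply]
  set P : ℝ → ℂ := fun x => ∫ y in c..x, E y with hP
  have hPd : ∀ x, HasDerivAt P (E x) x := fun x =>
    intervalIntegral.integral_hasDerivAt_right (hEc.intervalIntegrable _ _)
      (hEc.stronglyMeasurableAtFilter _ _) hEc.continuousAt
  have hint : ∫ x in c..d, Complex.exp (Complex.I * (F x : ℂ)) = P d := by
    refine intervalIntegral.integral_congr fun x hx => ?_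
    rw [uIcc_of_le hcd] at hx
    exact (hEF x hx).symm
  set Q : ℝ → ℂ := fun x => Complex.exp (Complex.I * (F x : ℂ)) / (Complex.I * (F' x : ℂ)) with hQ
  have hQnorm : ∀ x ∈ Icc c d, ‖Q x‖ = 1 / F' x := by
    intro x hx
    simp [hQ, mul_comm Complex.I, Complex.norm_exp_ofReal_mul_I, abs_of_pos (hpos x hx)]
  have hd : ∀ x ∈ Icc c d, HasDerivAt (fun x => P x - Q x)
      (Complex.exp (Complex.I * (F x : ℂ)) * (F'' x : ℂ) / (Complex.I * (F' x : ℂ) ^ 2)) x := by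
    intro x hx
    have hne : (F' x : ℂ) ≠ 0 := by exact_mod_cast (hpos x hx).ne'
    have h1 : HasDerivAt (fun y => Complex.exp (Complex.I * (F y : ℂ)))
        (Complex.exp (Complex.I * (F x : ℂ)) * (Complex.I * (F' x : ℂ))) x :=
      ((hF x hx).ofReal_comp.const_mul Complex.I).cexp
    have h2 : HasDerivAt (fun y => Complex.I * (F' y : ℂ)) (Complex.I * (F'' x : ℂ)) x :=
      (hF' x hx).ofReal_comp.const_mul Complex.I
    have h3 := (hPd x).sub (h1.div h2 (mul_ne_zero Complex.I_ne_zero hne))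
    refine h3.congr_deriv ?_
    rw [hEF x hx]
    have := Complex.I_ne_zero
    field_simp
    ring
  have hB : ∀ x ∈ Icc c d, HasDerivAt (fun x => 2 / F' c - 1 / F' x) (F'' x / F' x ^ 2) x := by
    intro x hx
    have h1 := (hasDerivAt_const x (2 / F' c)).sub
      ((hasDerivAt_const x (1 : ℝ)).div (hF' x hx) (hpos x hx).ne')
    refine h1.congr_deriv ?_
    ring
  have key : ‖P d - Q d‖ ≤ 2 / F' c - 1 / F' d := by
    refine image_norm_le_of_norm_deriv_right_le_deriv_boundary'
      (f := fun x => P x - Q x) (a := c) (b := d)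
      (B := fun x => 2 / F' c - 1 / F' x)
      (fun x hx => (hd x hx).continuousAt.continuousWithinAt)
      (fun x hx => (hd x (Ico_subset_Icc_self hx)).hasDerivWithinAt) ?_
      (fun x hx => (hB x hx).continuousAt.continuousWithinAt)
      (fun x hx => (hB x (Ico_subset_Icc_self hx)).hasDerivWithinAt) ?_ (right_mem_Icc.2 hcd)
    · have : P c = 0 := by simp [hP]
      simp only [this, zero_sub, norm_neg]
      rw [hQnorm c (left_mem_Icc.2 hcd)]
      exact le_of_eq (by ring)
    · intro x hx
      have hx' := Ico_subset_Icc_self hx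
      simp [mul_comm Complex.I, Complex.norm_exp_ofReal_mul_I, abs_of_nonneg (hF'' x hx')]
  rw [hint]
  calc ‖P d‖ = ‖(P d - Q d) + Q d‖ := by rw [sub_add_cancel]
    _ ≤ ‖P d - Q d‖ + ‖Q d‖ := norm_add_le _ _
    _ ≤ (2 / F' c - 1 / F' d) + 1 / F' d :=
      add_le_add key (hQnorm d (right_mem_Icc.2 hcd)).le
    _ = 2 / F' c := by ring
    _ ≤ 2 / m := by gcongr

/-- The trivial bound for the oscillatory integral of `exp (i F)`. -/
theorem norm_integral_exp_le_sub (F : ℝ → ℝ) {c d : ℝ} (hcd : c ≤ d) :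
    ‖∫ x in c..d, Complex.exp (Complex.I * (F x : ℂ))‖ ≤ d - c := by
  have := intervalIntegral.norm_integral_le_of_norm_le_const (a := c) (b := d) (C := 1)
    (f := fun x => Complex.exp (Complex.I * (F x : ℂ)))
    (fun x _ => by rw [mul_comm, Complex.norm_exp_ofReal_mul_I])
  rwa [one_mul, abs_of_nonneg (sub_nonneg.2 hcd)] at this

open Set in
theorem intervalIntegrable_exp_of_continuousOn {F : ℝ → ℝ} {c d : ℝ} (hcd : c ≤ d)
    (hF : ContinuousOn F (Icc c d)) :
    IntervalIntegrable (fun x => Complex.exp (Complex.I * (F x : ℂ))) MeasureTheory.volume c d := by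
  refine ContinuousOn.intervalIntegrable ?_
  rw [uIcc_of_le hcd]
  fun_prop

open Set in
/-- Second-derivative test when the phase is increasing. -/
theorem norm_integral_exp_le_of_deriv_nonneg {F F' F'' : ℝ → ℝ} {c d r : ℝ} (hcd : c ≤ d)
    (hr : 0 < r) (hF : ∀ x ∈ Icc c d, HasDerivAt F (F' x) x)
    (hF' : ∀ x ∈ Icc c d, HasDerivAt F' (F'' x) x)
    (hF'' : ∀ x ∈ Icc c d, r ≤ F'' x) (h0 : 0 ≤ F' c) :
    ‖∫ x in c..d, Complex.exp (Complex.I * (F x : ℂ))‖ ≤ 3 / √r := by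
  have hs : 0 < √r := Real.sqrt_pos.2 hr
  have hs2 : √r * √r = r := Real.mul_self_sqrt hr.le
  have hδ : 0 < 1 / √r := by positivity
  rcases le_or_gt d (c + 1 / √r) with h | h
  · refine (norm_integral_exp_le_sub F hcd).trans ?_
    have : 1 / √r ≤ 3 / √r := by gcongr; norm_num
    linarith
  have hFc : ContinuousOn F (Icc c d) := fun x hx => (hF x hx).continuousAt.continuousWithinAt
  set e := c + 1 / √r with he
  have hce : c ≤ e := by linarith
  have hsub1 : Icc c e ⊆ Icc c d := Icc_subset_Icc_right h.le
  have hsub2 : Icc e d ⊆ Icc c d := Icc_subset_Icc_left hce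
  rw [← intervalIntegral.integral_add_adjacent_intervals
    (intervalIntegrable_exp_of_continuousOn hce (hFc.mono hsub1))
    (intervalIntegrable_exp_of_continuousOn h.le (hFc.mono hsub2))]
  have hm : √r ≤ F' e := by
    have hgrow : r * (e - c) ≤ F' e - F' c := by
      refine (convex_Icc c d).mul_sub_le_image_sub_of_le_deriv
        (fun x hx => (hF' x hx).continuousAt.continuousWithinAt)
        (fun x hx => (hF' x (interior_subset hx)).differentiableAt.differentiableWithinAt)
        (fun x hx => ?_) c (left_mem_Icc.2 hcd) e ⟨hce, h.le⟩ hce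
      rw [(hF' x (interior_subset hx)).deriv]
      exact hF'' x (interior_subset hx)
    have : r * (e - c) = √r := by
      rw [he, add_sub_cancel_left]
      field_simp
      linarith
    linarith
  have h1 := norm_integral_exp_le_sub F hce
  have h2 := norm_integral_exp_le_of_le_deriv h.le hs (fun x hx => hF x (hsub2 hx))
    (fun x hx => hF' x (hsub2 hx)) (fun x hx => hr.le.trans (hF'' x (hsub2 hx))) hm
  calc _ ≤ (e - c) + 2 / √r := (norm_add_le _ _).trans (add_le_add h1 h2)
    _ = 3 / √r := by rw [he]; ring

open Set in
/-- Second-derivative test when the phase is decreasing. -/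
theorem norm_integral_exp_le_of_deriv_nonpos {F F' F'' : ℝ → ℝ} {c d r : ℝ} (hcd : c ≤ d)
    (hr : 0 < r) (hF : ∀ x ∈ Icc c d, HasDerivAt F (F' x) x)
    (hF' : ∀ x ∈ Icc c d, HasDerivAt F' (F'' x) x)
    (hF'' : ∀ x ∈ Icc c d, r ≤ F'' x) (h0 : F' d ≤ 0) :
    ‖∫ x in c..d, Complex.exp (Complex.I * (F x : ℂ))‖ ≤ 3 / √r := by
  have hneg : ∀ x ∈ Icc (-d) (-c), -x ∈ Icc c d := fun x hx =>
    ⟨by linarith [hx.2], by linarith [hx.1]⟩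
  have key := norm_integral_exp_le_of_deriv_nonneg (F := fun x => F (-x)) (F' := fun x => -F' (-x))
    (F'' := fun x => F'' (-x)) (neg_le_neg hcd) hr
    (fun x hx => 
      ((hF (-x) (hneg x hx)).comp x (hasDerivAt_neg x)).congr_deriv (by ring))
    (fun x hx => 
      ((hF' (-x) (hneg x hx)).comp x (hasDerivAt_neg x)).neg.congr_deriv (by ring))
    (fun x hx => hF'' _ (hneg x hx)) (by simpa using h0)
  rwa [intervalIntegral.integral_comp_neg (fun x => Complex.exp (Complex.I * (F x : ℂ))), neg_neg,
    neg_neg] at key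

open Set in
/-- Second-derivative test for the oscillatory integral of `exp (i F)` with convex phase. -/
theorem norm_integral_exp_le_of_le_second_deriv {F F' F'' : ℝ → ℝ} {c d r : ℝ} (hcd : c ≤ d)
    (hr : 0 < r) (hF : ∀ x ∈ Icc c d, HasDerivAt F (F' x) x)
    (hF' : ∀ x ∈ Icc c d, HasDerivAt F' (F'' x) x)
    (hF'' : ∀ x ∈ Icc c d, r ≤ F'' x) :
    ‖∫ x in c..d, Complex.exp (Complex.I * (F x : ℂ))‖ ≤ 6 / √r := by
  have h36 : 3 / √r ≤ 6 / √r := by gcongr; norm_num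
  rcases le_total 0 (F' c) with hc | hc
  · exact (norm_integral_exp_le_of_deriv_nonneg hcd hr hF hF' hF'' hc).trans h36
  rcases le_total (F' d) 0 with hd | hd
  · exact (norm_integral_exp_le_of_deriv_nonpos hcd hr hF hF' hF'' hd).trans h36
  obtain ⟨e, ⟨hce, hed⟩, he⟩ := intermediate_value_Icc hcd
    (fun x hx => (hF' x hx).continuousAt.continuousWithinAt : ContinuousOn F' (Icc c d)) ⟨hc, hd⟩
  have hFc : ContinuousOn F (Icc c d) := fun x hx => (hF x hx).continuousAt.continuousWithinAt
  have hsub1 : Icc c e ⊆ Icc c d := Icc_subset_Icc_right hed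
  have hsub2 : Icc e d ⊆ Icc c d := Icc_subset_Icc_left hce
  rw [← intervalIntegral.integral_add_adjacent_intervals
    (intervalIntegrable_exp_of_continuousOn hce (hFc.mono hsub1))
    (intervalIntegrable_exp_of_continuousOn hed (hFc.mono hsub2))]
  have h1 := norm_integral_exp_le_of_deriv_nonpos hce hr (fun x hx => hF x (hsub1 hx))
    (fun x hx => hF' x (hsub1 hx)) (fun x hx => hF'' x (hsub1 hx)) he.le
  have h2 := norm_integral_exp_le_of_deriv_nonneg hed hr (fun x hx => hF x (hsub2 hx))
    (fun x hx => hF' x (hsub2 hx)) (fun x hx => hF'' x (hsub2 hx)) he.ge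
  calc _ ≤ 3 / √r + 3 / √r := (norm_add_le _ _).trans (add_le_add h1 h2)
    _ = 6 / √r := by ring

theorem norm_integral_exp_neg (F : ℝ → ℝ) (c d : ℝ) :
    ‖∫ x in c..d, Complex.exp (Complex.I * ((-F x : ℝ) : ℂ))‖ =
      ‖∫ x in c..d, Complex.exp (Complex.I * (F x : ℂ))‖ := by
  have : ∀ x, Complex.exp (Complex.I * ((-F x : ℝ) : ℂ)) =
      (starRingEnd ℂ) (Complex.exp (Complex.I * (F x : ℂ))) := by
    intro x
    rw [← Complex.exp_conj]
    simp
  simp_rw [this]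
  rw [intervalIntegral.norm_integral_eq_norm_integral_uIoc,
    intervalIntegral.norm_integral_eq_norm_integral_uIoc, integral_conj, RCLike.norm_conj]

open Set in
/-- Weighted oscillatory integral with a monotone or antitone weight. -/
theorem norm_integral_mul_exp_le_of_monotoneOn {F G : ℝ → ℝ} {p q M C : ℝ} (hpq : p ≤ q)
    (hM : 0 ≤ M) (hC0 : 0 ≤ C) (hF : ContinuousOn F (Icc p q))
    (hG0 : ∀ x ∈ Icc p q, 0 ≤ G x) (hGM : ∀ x ∈ Icc p q, G x ≤ M)
    (hG : MonotoneOn G (Icc p q) ∨ AntitoneOn G (Icc p q))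
    (hC : ∀ c d, p ≤ c → c ≤ d → d ≤ q →
      ‖∫ x in c..d, Complex.exp (Complex.I * (F x : ℂ))‖ ≤ C) :
    ‖∫ x in p..q, (G x : ℂ) * Complex.exp (Complex.I * (F x : ℂ))‖ ≤ M * C := by
  set F₁ : ℝ → ℝ := fun x => F (projIcc p q hpq x) with hF₁
  set G₁ : ℝ → ℝ := fun x => G (projIcc p q hpq x) with hG₁
  have hproj : ∀ x ∈ Icc p q, (projIcc p q hpq x : ℝ) = x := fun x hx => by
    rw [projIcc_of_mem hpq hx]
  have hF₁c : Continuous F₁ :=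
    (continuousOn_iff_continuous_domRestrict.1 hF).comp continuous_projIcc
  have hG₁m : Monotone G₁ ∨ Antitone G₁ := hG.imp
    (fun h x y hxy => h (projIcc p q hpq x).2 (projIcc p q hpq y).2 (monotone_projIcc hpq hxy))
    (fun h x y hxy => h (projIcc p q hpq x).2 (projIcc p q hpq y).2 (monotone_projIcc hpq hxy))
  have hlev : ∀ s, {x | s < G₁ x}.OrdConnected := by
    intro s
    refine ⟨fun x hx y hy z hz => ?_⟩
    rcases hG₁m with h | h
    · exact lt_of_lt_of_le hx (h hz.1)
    · exact lt_of_lt_of_le hy (h hz.2)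
  have key := norm_integral_weight_mul_le
    (h := fun x => Complex.exp (Complex.I * (F₁ x : ℂ))) (by fun_prop)
    (hG₁m.elim Monotone.measurable Antitone.measurable) hpq hM hC0
    (fun x => hG0 _ (projIcc p q hpq x).2) (fun x => hGM _ (projIcc p q hpq x).2) hlev
    (fun c d hc hcd hd => by
      refine le_of_eq_of_le (congrArg _ (intervalIntegral.integral_congr fun x hx => ?_))
        (hC c d hc hcd hd)
      rw [uIcc_of_le hcd] at hx
      simp only [hF₁, hproj x ⟨hc.trans hx.1, hx.2.trans hd⟩])
  refine le_of_eq_of_le (congrArg _ (intervalIntegral.integral_congr fun x hx => ?_)) key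
  rw [uIcc_of_le hpq] at hx
  simp only [hF₁, hG₁, hproj x hx]

/-- Second-derivative test: if `F` is twice differentiable on `[a,b]` with
`F'' > r > 0` throughout or `F'' < -r < 0` throughout, and `G` satisfies
`0 ≤ G ≤ M` and is piecewise monotonic with `K` monotonic pieces, then
`|∫_a^b G(x) e^{iF(x)} dx| ≤ 8KM/√r`. -/
theorem oscillatory_integral_second_derivative_test
    (a b r M : ℝ) (K : ℕ) (hab : a ≤ b) (hr : 0 < r) (hM : 0 < M) (hK : 1 ≤ K)
    (F F' F'' G : ℝ → ℝ)
    (hF : ∀ x ∈ Set.Icc a b, HasDerivAt F (F' x) x)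
    (hF' : ∀ x ∈ Set.Icc a b, HasDerivAt F' (F'' x) x)
    (hF'' : (∀ x ∈ Set.Icc a b, r < F'' x) ∨ (∀ x ∈ Set.Icc a b, F'' x < -r))
    (hG0 : ∀ x ∈ Set.Icc a b, 0 ≤ G x) (hGM : ∀ x ∈ Set.Icc a b, G x ≤ M)
    (t : ℕ → ℝ) (ht0 : t 0 = a) (htK : t K = b)
    (ht : ∀ i < K, t i ≤ t (i + 1))
    (htG : ∀ i < K, MonotoneOn G (Set.Icc (t i) (t (i + 1))) ∨
      AntitoneOn G (Set.Icc (t i) (t (i + 1)))) :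
    ‖∫ x in a..b, (G x : ℂ) * Complex.exp (Complex.I * (F x : ℂ))‖ ≤
      8 * K * M / Real.sqrt r := by
  have hexp : ∀ c d, a ≤ c → c ≤ d → d ≤ b →
      ‖∫ x in c..d, Complex.exp (Complex.I * (F x : ℂ))‖ ≤ 8 / √r := by
    intro c d hc hcd hd
    have hsub : Set.Icc c d ⊆ Set.Icc a b := Set.Icc_subset_Icc hc hd
    have h68 : 6 / √r ≤ 8 / √r := by gcongr; norm_num
    refine le_trans ?_ h68
    rcases hF'' with h | h
    · exact norm_integral_exp_le_of_le_second_deriv hcd hr (fun x hx => hF x (hsub hx))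
        (fun x hx => hF' x (hsub hx)) (fun x hx => (h x (hsub hx)).le)
    · rw [← norm_integral_exp_neg]
      exact norm_integral_exp_le_of_le_second_deriv (F := fun x => -F x) (F' := fun x => -F' x)
        (F'' := fun x => -F'' x) hcd hr (fun x hx => (hF x (hsub hx)).neg)
        (fun x hx => (hF' x (hsub hx)).neg) (fun x hx => by linarith [h x (hsub hx)])
  have hmono : MonotoneOn t (Set.Iic K) := by
    refine monotoneOn_of_le_add_one Set.ordConnected_Iic fun i _ _ hi => ht i ?_
    exact Nat.lt_of_succ_le hi
  have hsub : ∀ i < K, Set.Icc (t i) (t (i + 1)) ⊆ Set.Icc a b := by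
    intro i hi
    refine Set.Icc_subset_Icc ?_ ?_
    · rw [← ht0]
      exact hmono (Nat.zero_le K) hi.le (Nat.zero_le i)
    · rw [← htK]
      exact hmono (Nat.succ_le_of_lt hi) Set.self_mem_Iic (Nat.succ_le_of_lt hi)
  have hFc : ContinuousOn F (Set.Icc a b) := fun x hx =>
    (hF x hx).continuousAt.continuousWithinAt
  have hint : ∀ i < K, IntervalIntegrable
      (fun x => (G x : ℂ) * Complex.exp (Complex.I * (F x : ℂ))) MeasureTheory.volume
      (t i) (t (i + 1)) := by
    intro i hi
    have hGi : IntervalIntegrable G MeasureTheory.volume (t i) (t (i + 1)) := by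
      have := htG i hi
      rw [← Set.uIcc_of_le (ht i hi)] at this
      exact this.elim MonotoneOn.intervalIntegrable AntitoneOn.intervalIntegrable
    refine IntervalIntegrable.mul_continuousOn ⟨hGi.1.ofReal, hGi.2.ofReal⟩ ?_
    rw [Set.uIcc_of_le (ht i hi)]
    have := hFc.mono (hsub i hi)
    fun_prop
  rw [← ht0, ← htK, ← intervalIntegral.sum_integral_adjacent_intervals hint]
  calc _ ≤ ∑ i ∈ Finset.range K, M * (8 / √r) := by
        refine norm_sum_le_of_le _ fun i hi => ?_
        have hi' := Finset.mem_range.1 hi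
        have hs := hsub i hi'
        have hl := hs (Set.left_mem_Icc.2 (ht i hi'))
        have hu := hs (Set.right_mem_Icc.2 (ht i hi'))
        exact norm_integral_mul_exp_le_of_monotoneOn (ht i hi') hM.le (by positivity)
          (hFc.mono hs) (fun x hx => hG0 x (hs hx)) (fun x hx => hGM x (hs hx)) (htG i hi')
          fun c d hc hcd hd => hexp c d (hl.1.trans hc) hcd (hd.trans hu.2)
    _ = 8 * K * M / √r := by
        rw [Finset.sum_const, Finset.card_range, nsmul_eq_mul]
        ring
end

section
/- Fix b ≥ 2. There is a constant C depending only on b such that for all integers a and m with gcd(a, b) = 1, every N ≥ 1, and every positive divisor c of b^N, one has |K₂(m, a, c)| ≤ C. -/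
/-- The additive character `e(z/c)` for `z ∈ ℤ/cℤ`. -/
noncomputable def eMod (c : ℕ) (z : ZMod c) : ℂ :=
  Complex.exp (2 * Real.pi * Complex.I * ((z.val : ℂ) / (c : ℂ)))

/-- The quadratic Kloosterman sum
`K₂(a₁,a₂,c) = c^{-1/2} Σ_{1 ≤ x ≤ c, (x,c)=1} e((a₁x + a₂x̄²)/c)`. -/
noncomputable def K2 (a₁ a₂ : ℤ) (c : ℕ) : ℂ :=
  ((Real.sqrt c)⁻¹ : ℝ) * ∑ x ∈ Finset.Icc 1 c,
    if Nat.gcd x c = 1 then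
      eMod c ((a₁ : ZMod c) * (x : ZMod c) + (a₂ : ZMod c) * ((x : ZMod c)⁻¹) ^ 2)
    else 0

open Finset

lemma card_rootsOfUnity_three_zmod_prime_pow (p k : ℕ) (hp : p.Prime) :
    Nat.card (rootsOfUnity 3 (ZMod (p ^ k))) ≤ 3 := by
  have : NeZero (p ^ k) := ⟨pow_ne_zero _ hp.ne_zero⟩
  rcases eq_or_ne p 2 with rfl | h2
  · have hcop : (Nat.card (ZMod (2 ^ k))ˣ).Coprime 3 := by
      rw [Nat.card_eq_fintype_card, ZMod.card_units_eq_totient]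
      rcases Nat.eq_zero_or_pos k with rfl | hk
      · simp
      · rw [Nat.totient_prime_pow hp hk]
        simpa using Nat.Coprime.pow_left (k - 1) (by norm_num : Nat.Coprime 2 3)
    have : Subsingleton (rootsOfUnity 3 (ZMod (2 ^ k))) :=
      ⟨fun u v ↦ Subtype.ext (hcop.pow_left_bijective.1 (u.2.trans v.2.symm))⟩
    exact (Finite.card_le_one_iff_subsingleton.mpr this).trans (by norm_num)
  · have := ZMod.isCyclic_units_of_prime_pow p hp h2 k
    have h := IsCyclic.card_pow_eq_one_le (α := (ZMod (p ^ k))ˣ) (n := 3) (by norm_num)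
    rwa [← Fintype.card_subtype, ← Nat.card_eq_fintype_card] at h

lemma card_rootsOfUnity_zmod_mul_le (n d e : ℕ) [NeZero n] [NeZero d] [NeZero e]
    (h : d.Coprime e) :
    Nat.card (rootsOfUnity n (ZMod (d * e))) ≤
      Nat.card (rootsOfUnity n (ZMod d)) * Nat.card (rootsOfUnity n (ZMod e)) := by
  rw [← Nat.card_prod]
  let σ := ZMod.chineseRemainder h
  let f := restrictRootsOfUnity ((RingHom.fst _ _).comp (σ : ZMod (d * e) →+* ZMod d × ZMod e)) n
  let g := restrictRootsOfUnity ((RingHom.snd _ _).comp (σ : ZMod (d * e) →+* ZMod d × ZMod e)) n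
  refine Nat.card_le_card_of_injective (fun u ↦ (f u, g u)) fun u v huv ↦ ?_
  have hf := congrArg (fun w ↦ ((w.1 : (ZMod d)ˣ) : ZMod d)) huv
  have hg := congrArg (fun w ↦ ((w.2 : (ZMod e)ˣ) : ZMod e)) huv
  exact Subtype.ext (Units.ext (σ.injective (Prod.ext hf hg)))

lemma card_rootsOfUnity_three_zmod_le (n : ℕ) (hn : n ≠ 0) :
    Nat.card (rootsOfUnity 3 (ZMod n)) ≤ 3 ^ #n.primeFactors := by
  induction n using Nat.recOnPosPrimePosCoprime with
  | zero => exact absurd rfl hn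
  | one =>
    have : Subsingleton (ZMod 1)ˣ := ⟨fun u v ↦ Units.ext (Subsingleton.elim _ _)⟩
    simp
  | prime_pow p k hp hk =>
    rw [Nat.primeFactors_prime_pow hk.ne' hp, card_singleton, pow_one]
    exact card_rootsOfUnity_three_zmod_prime_pow p k hp
  | coprime d e hd he hde ihd ihe =>
    have : NeZero d := ⟨by omega⟩
    have : NeZero e := ⟨by omega⟩
    rw [hde.primeFactors_mul, card_union_of_disjoint hde.disjoint_primeFactors, pow_add]
    exact (card_rootsOfUnity_zmod_mul_le 3 d e hde).trans
      (Nat.mul_le_mul (ihd (NeZero.ne d)) (ihe (NeZero.ne e)))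

lemma card_units_nsmul_pow_sub_one_eq_zero_le (n r c : ℕ) (hr : 0 < r) [NeZero c] :
    #{u : (ZMod c)ˣ | r • ((u : ZMod c) ^ n - 1) = 0} ≤
      Nat.card (rootsOfUnity n (ZMod c)) * r := by
  classical
  have hval : #{v : (ZMod c)ˣ | r • ((v : ZMod c) - 1) = 0} ≤ r := by
    refine le_trans (card_le_card_of_injOn (fun v ↦ (v : ZMod c) - 1) (fun v hv ↦ ?_) ?_)
      (IsAddCyclic.card_nsmul_eq_zero_le (α := ZMod c) hr)
    · simpa using hv
    · exact fun u _ v _ huv ↦ Units.ext (sub_left_injective huv)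
  refine le_trans (card_le_mul_card_image_of_maps_to (f := fun u ↦ u ^ n)
    (t := {v : (ZMod c)ˣ | r • ((v : ZMod c) - 1) = 0}) (fun u hu ↦ ?_) _ fun v _ ↦ ?_)
    (Nat.mul_le_mul_left _ hval)
  · simpa using hu
  · rw [Nat.card_eq_fintype_card]
    rcases eq_empty_or_nonempty
      {u ∈ ({u : (ZMod c)ˣ | r • ((u : ZMod c) ^ n - 1) = 0} : Finset _) | u ^ n = v}
      with h | ⟨w, hw⟩
    · rw [h]
      simp
    · have hwv : w ^ n = v := (mem_filter.mp hw).2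
      rw [← card_univ]
      refine card_le_card_of_surjOn (fun u ↦ w * (u : (ZMod c)ˣ)) fun u hu ↦ ?_
      have huv : u ^ n = v := (mem_filter.mp hu).2
      refine ⟨⟨w⁻¹ * u, ?_⟩, by simp, by simp⟩
      rw [mem_rootsOfUnity, mul_pow, inv_pow, hwv, huv, inv_mul_cancel]

lemma eMod_eq_stdAddChar (c : ℕ) [NeZero c] (z : ZMod c) : eMod c z = ZMod.stdAddChar z := by
  rw [ZMod.stdAddChar_apply, ZMod.toCircle_apply, eMod, mul_div_assoc]

/-- The summand of the quadratic Kloosterman sum, extended by zero to non-units. -/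
noncomputable def kloostermanTerm (m a : ℤ) (c : ℕ) [NeZero c] (x : ZMod c) : ℂ :=
  open Classical in if IsUnit x then ZMod.stdAddChar ((m : ZMod c) * x + (a : ZMod c) * x⁻¹ ^ 2) else 0

lemma norm_kloostermanTerm_le_one (m a : ℤ) (c : ℕ) [NeZero c] (x : ZMod c) :
    ‖kloostermanTerm m a c x‖ ≤ 1 := by
  unfold kloostermanTerm
  split_ifs
  · exact (AddChar.norm_apply _ _).le
  · simp

lemma K2_eq_sum_kloostermanTerm (m a : ℤ) (c : ℕ) [NeZero c] :
    K2 m a c = ((Real.sqrt c)⁻¹ : ℝ) * ∑ x : ZMod c, kloostermanTerm m a c x := by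
  rw [K2]
  congr 1
  refine sum_bij' (fun x _ ↦ (x : ZMod c)) (fun x _ ↦ if x = 0 then c else x.val)
    (fun _ _ ↦ mem_univ _) (fun x _ ↦ ?_) (fun x hx ↦ ?_) (fun x _ ↦ ?_) fun x _ ↦ ?_
  · have hc := NeZero.pos c
    have := x.val_lt
    split_ifs with h
    · simp; omega
    · have := (ZMod.val_ne_zero x).mpr h
      simp; omega
  · obtain ⟨h1, h2⟩ := mem_Icc.mp hx
    rcases h2.eq_or_lt with rfl | h2
    · simp
    · have hx0 : (x : ZMod c) ≠ 0 := by
        rw [Ne, ZMod.natCast_eq_zero_iff]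
        exact Nat.not_dvd_of_pos_of_lt h1 h2
      rw [if_neg hx0, ZMod.val_cast_of_lt h2]
  · split_ifs with h <;> simp [h]
  · rw [kloostermanTerm, eMod_eq_stdAddChar]
    congr 1
    exact propext (ZMod.isUnit_iff_coprime x c).symm

lemma kloostermanTerm_add (m a : ℤ) (c : ℕ) [NeZero c] (x h : ZMod c) (hh : h ^ 2 = 0) :
    kloostermanTerm m a c (x + h) =
      kloostermanTerm m a c x * ZMod.stdAddChar (h * ((m : ZMod c) - 2 * (a : ZMod c) * x⁻¹ ^ 3)) := by
  have hnil : IsNilpotent h := ⟨2, hh⟩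
  by_cases hx : IsUnit x
  · have hxh : IsUnit (x + h) := hnil.isUnit_add_left_of_commute hx (Commute.all _ _)
    rw [kloostermanTerm, kloostermanTerm, if_pos hx, if_pos hxh, ← AddChar.map_add_eq_mul]
    congr 1
    have e1 : x * x⁻¹ = 1 := ZMod.mul_inv_of_unit x hx
    have e2 : (x + h)⁻¹ = x⁻¹ - h * x⁻¹ ^ 2 := by
      refine hxh.mul_left_cancel ?_
      rw [ZMod.mul_inv_of_unit _ hxh]
      linear_combination (-1 + h * x⁻¹) * e1 + x⁻¹ ^ 2 * hh
    rw [e2]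
    linear_combination (a : ZMod c) * x⁻¹ ^ 4 * hh
  · have hxh : ¬ IsUnit (x + h) := fun H ↦ hx <| by
      simpa using hnil.neg.isUnit_add_left_of_commute H (Commute.all _ _)
    simp [kloostermanTerm, hx, hxh]

lemma sum_kloostermanTerm_eq (m a : ℤ) (c q : ℕ) [NeZero c] (hq : c ∣ q ^ 2) :
    ∑ x : ZMod c, kloostermanTerm m a c x =
      ∑ x : ZMod c with (q : ZMod c) * ((m : ZMod c) - 2 * (a : ZMod c) * x⁻¹ ^ 3) = 0, kloostermanTerm m a c x := by
  have hq0 : (q : ZMod c) ^ 2 = 0 := by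
    exact_mod_cast (ZMod.natCast_eq_zero_iff (q ^ 2) c).mpr hq
  have hc : (c : ℂ) ≠ 0 := Nat.cast_ne_zero.mpr (NeZero.ne c)
  refine mul_left_cancel₀ hc ?_
  calc (c : ℂ) * ∑ x : ZMod c, kloostermanTerm m a c x
      = ∑ t : ZMod c, ∑ x : ZMod c, kloostermanTerm m a c (x + t * q) := by
        have h (t : ZMod c) : ∑ x : ZMod c, kloostermanTerm m a c (x + t * q) =
            ∑ x : ZMod c, kloostermanTerm m a c x :=
          Fintype.sum_equiv (Equiv.addRight (t * (q : ZMod c))) _ _ fun _ ↦ rfl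
        simp [h]
    _ = ∑ x : ZMod c, kloostermanTerm m a c x *
          ∑ t : ZMod c, ZMod.stdAddChar (t * ((q : ZMod c) * ((m : ZMod c) - 2 * (a : ZMod c) * x⁻¹ ^ 3))) := by
        rw [sum_comm]
        refine sum_congr rfl fun x _ ↦ ?_
        rw [mul_sum]
        refine sum_congr rfl fun t _ ↦ ?_
        rw [kloostermanTerm_add _ _ _ _ _ (by rw [mul_pow, hq0, mul_zero]), mul_assoc t]
    _ = _ := by
        rw [mul_sum, sum_filter]
        refine sum_congr rfl fun x _ ↦ ?_
        rw [AddChar.sum_mulShift _ (ZMod.isPrimitive_stdAddChar c), ZMod.card]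
        split_ifs <;> simp [mul_comm]

lemma card_critical_units_le (m a : ℤ) (c q : ℕ) [NeZero c] (hq : 0 < q)
    (ha : IsUnit (a : ZMod c)) :
    #{u : (ZMod c)ˣ | (q : ZMod c) * ((m : ZMod c) - 2 * (a : ZMod c) * (u : ZMod c)⁻¹ ^ 3) = 0} ≤
      3 ^ #c.primeFactors * (2 * q) := by
  rcases eq_empty_or_nonempty
    ({u : (ZMod c)ˣ | (q : ZMod c) * ((m : ZMod c) - 2 * (a : ZMod c) * (u : ZMod c)⁻¹ ^ 3) = 0} : Finset _)
    with h | ⟨w, hw⟩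
  · rw [h]
    simp
  refine le_trans (card_le_card_of_injOn (fun u ↦ w * u⁻¹) (fun u hu ↦ ?_) ?_)
    ((card_units_nsmul_pow_sub_one_eq_zero_le 3 (2 * q) c (by omega)).trans
      (Nat.mul_le_mul_right _ (card_rootsOfUnity_three_zmod_le c (NeZero.ne c))))
  · simp only [coe_filter, mem_univ, true_and, Set.mem_ofPred_eq, mem_filter, ZMod.inv_coe_unit]
      at hu hw ⊢
    have e : (w : ZMod c) * ↑w⁻¹ = 1 := w.mul_inv
    refine ha.mul_left_cancel ?_
    rw [nsmul_eq_mul]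
    push_cast
    linear_combination (w : ZMod c) ^ 3 * (hw - hu) +
      2 * (q : ZMod c) * a * ((w : ZMod c) ^ 2 * (↑w⁻¹ : ZMod c) ^ 2 + w * ↑w⁻¹ + 1) * e
  · exact fun u _ v _ huv ↦ inv_injective (mul_left_cancel huv)

lemma norm_sum_kloostermanTerm_le (m a : ℤ) (c q : ℕ) [NeZero c] (hq : 0 < q) (hcq : c ∣ q ^ 2)
    (ha : IsUnit (a : ZMod c)) :
    ‖∑ x : ZMod c, kloostermanTerm m a c x‖ ≤ 3 ^ #c.primeFactors * (2 * q) := by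
  classical
  rw [sum_kloostermanTerm_eq m a c q hcq]
  have hcard := card_critical_units_le m a c q hq ha
  set s : Finset (ZMod c)ˣ := {u | (q : ZMod c) * ((m : ZMod c) - 2 * (a : ZMod c) * (u : ZMod c)⁻¹ ^ 3) = 0} with hs
  have hsum : ∑ x : ZMod c with (q : ZMod c) * ((m : ZMod c) - 2 * (a : ZMod c) * x⁻¹ ^ 3) = 0, kloostermanTerm m a c x =
      ∑ u ∈ s, kloostermanTerm m a c u := by
    symm
    refine sum_of_injOn (fun u : (ZMod c)ˣ ↦ (u : ZMod c)) (fun u _ v _ h ↦ Units.ext h)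
      (fun u hu ↦ ?_) (fun x hx hxs ↦ ?_) fun _ _ ↦ rfl
    · simpa [hs] using hu
    · refine if_neg fun hu ↦ hxs ⟨hu.unit, ?_, rfl⟩
      simpa [hs, -ZMod.inv_coe_unit] using hx
  rw [hsum]
  calc ‖∑ u ∈ s, kloostermanTerm m a c u‖ ≤ ∑ u ∈ s, (1 : ℝ) :=
        norm_sum_le_of_le _ fun u _ ↦ norm_kloostermanTerm_le_one _ _ _ _
    _ = #s := by simp
    _ ≤ _ := by exact_mod_cast hcard

/-- For fixed `b ≥ 2` there is a constant `C = C(b)` such that for all integers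
`a, m` with `gcd(a,b) = 1`, all `N ≥ 1` and every divisor `c` of `b^N`,
`|K₂(m, a, c)| ≤ C`. -/
theorem K2_bounded (b : ℕ) (hb : 2 ≤ b) :
    ∃ C : ℝ, ∀ a m : ℤ, Int.gcd a (b : ℤ) = 1 → ∀ N : ℕ, 1 ≤ N → ∀ c : ℕ,
      c ∣ b ^ N → ‖K2 m a c‖ ≤ C := by
  refine ⟨3 ^ #b.primeFactors * (2 * √b), fun a m hab N hN c hc ↦ ?_⟩
  have hb0 : b ≠ 0 := by omega
  have hc0 : c ≠ 0 := ne_zero_of_dvd_ne_zero (pow_ne_zero N hb0) hc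
  have : NeZero c := ⟨hc0⟩
  have ha : IsUnit (a : ZMod c) := by
    rw [ZMod.coe_int_isUnit_iff_isCoprime]
    have h : IsCoprime ((b : ℤ) ^ N) a := (Int.isCoprime_iff_gcd_eq_one.mpr hab).symm.pow_left
    refine h.of_isCoprime_of_dvd_left ?_
    exact_mod_cast hc
  obtain ⟨e, d, hde, he⟩ := Nat.sq_mul_squarefree c
  have hd0 : d ≠ 0 := by rintro rfl; simp at hde; omega
  have heb : e ∣ b := (he.dvd_pow_iff_dvd (by omega)).mp ((Dvd.intro_left _ hde).trans hc)
  have he0 : 0 < e := Nat.pos_of_dvd_of_pos heb (by omega)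
  have hω : #c.primeFactors ≤ #b.primeFactors := by
    rw [← Nat.primeFactors_pow b (by omega : N ≠ 0)]
    exact card_le_card (Nat.primeFactors_mono hc (pow_ne_zero N hb0))
  have hsum := norm_sum_kloostermanTerm_le m a c (d * e) (by positivity)
    ⟨e, by rw [← hde]; ring⟩ ha
  have hsc : √(c : ℝ) = d * √e := by
    rw [← hde]
    push_cast
    rw [Real.sqrt_mul (by positivity), Real.sqrt_sq (by positivity)]
  have hsc0 : 0 < √(c : ℝ) := Real.sqrt_pos.mpr (by positivity)
  have hee : (e : ℝ) = √e * √e := (Real.mul_self_sqrt (by positivity)).symm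
  have hle : √(e : ℝ) ≤ √b :=
    Real.sqrt_le_sqrt (by exact_mod_cast Nat.le_of_dvd (by omega) heb)
  rw [K2_eq_sum_kloostermanTerm, norm_mul, Complex.norm_real, norm_inv,
    Real.norm_of_nonneg hsc0.le, inv_mul_le_iff₀ hsc0]
  calc ‖∑ x : ZMod c, kloostermanTerm m a c x‖
      ≤ 3 ^ #c.primeFactors * (2 * ((d * e : ℕ) : ℝ)) := hsum
    _ = √c * (3 ^ #c.primeFactors * (2 * √e)) := by
        push_cast
        rw [hsc]
        linear_combination (3 ^ #c.primeFactors * 2 * d : ℝ) * hee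
    _ ≤ √c * (3 ^ #b.primeFactors * (2 * √b)) := by
        gcongr
        norm_num
end
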